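/- Let 𝐟 : ℝ² → ℝ be a C² function on the open unit disk D = {(u,v) : u² + v² < 1} satisfying the minimal surface equation on D. Suppose the point of the graph above the origin is symmetric, i.e. there exists a unit vector h = (h₁,h₂) ∈ ℝ² such that the directional derivative ∇_h𝐟(0,0) = h₁ ∂_u𝐟(0,0) + h₂ ∂_v𝐟(0,0) = 0 and the mixed second directional derivative ∇²_{h,ih}𝐟(0,0) = 0, where ih = (−h₂, h₁). Then the Gaussian curvature K of the graph of 𝐟 at the point above the origin satisfies |K| < π²/2. -/

import Mathlib

open Real Set

/-- Partial derivative in the `u` (first coordinate) direction. -/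
noncomputable def pdu (f : ℝ × ℝ → ℝ) (p : ℝ × ℝ) : ℝ := lineDeriv ℝ f p (1, 0)

/-- Partial derivative in the `v` (second coordinate) direction. -/
noncomputable def pdv (f : ℝ × ℝ → ℝ) (p : ℝ × ℝ) : ℝ := lineDeriv ℝ f p (0, 1)

/-- The open unit disk in `ℝ²`. -/
def unitDisk : Set (ℝ × ℝ) := {p | p.1 ^ 2 + p.2 ^ 2 < 1}

/-- The Gaussian curvature of the graph of `f` at the point above `p`. -/
noncomputable def gaussCurv (f : ℝ × ℝ → ℝ) (p : ℝ × ℝ) : ℝ :=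
  (pdu (pdu f) p * pdv (pdv f) p - (pdv (pdu f) p) ^ 2) /
    (1 + (pdu f p) ^ 2 + (pdv f p) ^ 2) ^ 2

/-- `f` satisfies the minimal surface equation on `D`. -/
def MinimalSurfaceEq (f : ℝ × ℝ → ℝ) (D : Set (ℝ × ℝ)) : Prop :=
  ∀ p ∈ D, (1 + (pdv f p) ^ 2) * pdu (pdu f) p
      - 2 * pdu f p * pdv f p * pdv (pdu f) p
      + (1 + (pdu f p) ^ 2) * pdv (pdv f) p = 0

/-- `ζ` is an `h`-symmetric point of `f`: `h` is a unit vector,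
`∇ₕ f(ζ) = 0` and `∇²_{h, ih} f(ζ) = 0` where `ih = (-h₂, h₁)`. -/
def IsSymmetricPt (f : ℝ × ℝ → ℝ) (ζ : ℝ × ℝ) (h : ℝ × ℝ) : Prop :=
  h.1 ^ 2 + h.2 ^ 2 = 1 ∧ lineDeriv ℝ f ζ h = 0 ∧
    lineDeriv ℝ (fun p => lineDeriv ℝ f p h) ζ (-h.2, h.1) = 0

open Complex Metric MeasureTheory in
/-- A Cauchy–Pompeiu estimate in logarithmic coordinates: if the antiholomorphic part of the
derivative of `ℓ` is bounded, then circle averages are Lipschitz in the radius. -/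
theorem norm_integral_circle_sub_le {ℓ : ℂ → ℂ} {c : ℂ} {r R C : ℝ} {s : Set ℂ}
    (hs : s.Countable) (hr : 0 < r) (hrR : r ≤ R) (hC : 0 ≤ C)
    (hc : ContinuousOn ℓ (closedBall c R))
    (hd : ∀ z ∈ ball c R \ s, DifferentiableAt ℝ ℓ z)
    (hb : ∀ z ∈ ball c R \ s, ‖I * fderiv ℝ ℓ z 1 - fderiv ℝ ℓ z I‖ ≤ C) :
    ‖(∫ θ in (0 : ℝ)..2 * π, ℓ (c + R * exp (θ * I))) -
      ∫ θ in (0 : ℝ)..2 * π, ℓ (c + r * exp (θ * I))‖ ≤ 2 * π * C * (R - r) := by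
  have hR : 0 < R := hr.trans_le hrR
  have hlog : Real.log r ≤ Real.log R := Real.log_le_log hr hrR
  set g : ℂ → ℂ := fun w => ℓ (c + exp w) with hg
  have hmem : ∀ w : ℂ, w.re ≤ Real.log R → c + exp w ∈ closedBall c R := by
    intro w hw
    simp only [mem_closedBall, dist_self_add_left, Complex.norm_exp]
    calc Real.exp w.re ≤ Real.exp (Real.log R) := Real.exp_le_exp.2 hw
      _ = R := Real.exp_log hR
  have hmem' : ∀ w : ℂ, w.re < Real.log R → c + exp w ∈ ball c R := by
    intro w hw
    simp only [mem_ball, dist_self_add_left, Complex.norm_exp]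
    calc Real.exp w.re < Real.exp (Real.log R) := Real.exp_lt_exp.2 hw
      _ = R := Real.exp_log hR
  set S : Set ℂ := exp ⁻¹' ((fun z => c + z) ⁻¹' s) with hS
  have hSc : S.Countable :=
    countable_preimage_exp.2 (hs.preimage (add_right_injective c))
  have hgd : ∀ w : ℂ, w.re < Real.log R → w ∉ S →
      HasFDerivAt g ((fderiv ℝ ℓ (c + exp w)).comp
        ((ContinuousLinearMap.toSpanSingleton ℂ (exp w)).restrictScalars ℝ)) w := by
    intro w hw hwS
    have h1 : HasFDerivAt (fun w : ℂ => c + exp w)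
        ((ContinuousLinearMap.toSpanSingleton ℂ (exp w)).restrictScalars ℝ) w :=
      ((Complex.hasDerivAt_exp w).const_add c).hasFDerivAt.restrictScalars ℝ
    exact (hd _ ⟨hmem' w hw, hwS⟩).hasFDerivAt.comp w h1
  have hbound : ∀ w : ℂ, w.re < Real.log R → w ∉ S →
      ‖I • fderiv ℝ g w 1 - fderiv ℝ g w I‖ ≤ C * Real.exp w.re := by
    intro w hw hwS
    rw [(hgd w hw hwS).fderiv]
    set L := fderiv ℝ ℓ (c + exp w)
    have hL : ∀ x : ℂ, L x = x.re * L 1 + x.im * L I := by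
      intro x
      conv_lhs => rw [← re_add_im x]
      have : (x.re : ℂ) + x.im * I = x.re • (1 : ℂ) + x.im • I := by simp
      rw [this, map_add, map_smul, map_smul]; simp
    have : I • (L.comp ((ContinuousLinearMap.toSpanSingleton ℂ (exp w)).restrictScalars ℝ)) 1 -
        (L.comp ((ContinuousLinearMap.toSpanSingleton ℂ (exp w)).restrictScalars ℝ)) I =
        (starRingEnd ℂ) (exp w) * (I * L 1 - L I) := by
      simp only [ContinuousLinearMap.comp_apply, ContinuousLinearMap.coe_restrictScalars',
        ContinuousLinearMap.toSpanSingleton_apply, smul_eq_mul, one_mul]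
      rw [hL (exp w), hL (I * exp w)]
      have e : (starRingEnd ℂ) (exp w) = (exp w).re - (exp w).im * I := by
        apply Complex.ext <;> simp
      rw [e]
      simp only [I_mul_re, I_mul_im, ofReal_neg]
      linear_combination ((exp w).im * L 1 : ℂ) * I_sq
    rw [this, norm_mul, RCLike.norm_conj, Complex.norm_exp, mul_comm]
    exact mul_le_mul_of_nonneg_right (hb _ ⟨hmem' w hw, hwS⟩) (Real.exp_pos _).le
  have hae : ∀ᵐ w : ℂ, w.re ≠ Real.log R ∧ w ∉ S := by
    have h2 : ∀ᵐ w : ℂ, w ∉ S := by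
      have := hSc.measure_zero volume
      exact measure_eq_zero_iff_ae_notMem.1 this
    have h1 : ∀ᵐ w : ℂ, w.re ≠ Real.log R := by
      have : volume {w : ℂ | w.re = Real.log R} = 0 := by
        have := volume_preserving_equiv_real_prod.symm.measure_preimage_equiv {w : ℂ | w.re = Real.log R}
        rw [← this]
        have h3 : (measurableEquivRealProd.symm ⁻¹' {w : ℂ | w.re = Real.log R}) =
            {Real.log R} ×ˢ (univ : Set ℝ) := by
          ext ⟨x, y⟩; simp [measurableEquivRealProd]
        rw [h3, Measure.volume_eq_prod, Measure.prod_prod]; simp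
      exact measure_eq_zero_iff_ae_notMem.1 this
    filter_upwards [h1, h2] with w a b using ⟨a, b⟩
  have key := integral_boundary_rect_of_hasFDerivAt_real_off_countable g (fderiv ℝ g)
    (Real.log r) (Real.log R + 2 * π * I) S hSc ?_ ?_ ?_
  rotate_left
  · refine hc.comp (by fun_prop) ?_
    intro w hw
    refine hmem w ?_
    have := hw.1
    simp only [mem_preimage] at this
    simp [hlog] at this
    exact this.2
  · intro w hw
    have h1 := hw.1.1
    simp [hlog] at h1
    exact (hgd w h1.2 hw.2).differentiableAt.hasFDerivAt
  · refine IntegrableOn.of_bound ?_ ?_ (C * R) ?_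
    · exact ((Metric.isBounded_Icc _ _).reProdIm (Metric.isBounded_Icc _ _)).measure_lt_top
    · have h1 := measurable_fderiv ℝ g
      refine Measurable.aestronglyMeasurable ?_
      refine Measurable.sub ?_ ?_
      · exact ((h1.apply_continuousLinearMap 1).const_smul I)
      · exact h1.apply_continuousLinearMap I
    · refine (ae_restrict_iff' ?_).2 ?_
      · exact (measurable_re measurableSet_uIcc).inter (measurable_im measurableSet_uIcc)
      · filter_upwards [hae] with w hw hw2
        have h1 := hw2.1
        simp [hlog] at h1
        refine (hbound w (lt_of_le_of_ne h1.2 hw.1) hw.2).trans ?_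
        refine mul_le_mul_of_nonneg_left ?_ hC
        calc Real.exp w.re ≤ Real.exp (Real.log R) := Real.exp_le_exp.2 h1.2
          _ = R := Real.exp_log hR
  have hper : ∀ x : ℝ, g (x + 2 * π * I) = g x := by
    intro x
    simp [hg, Complex.exp_add]
  have hcirc : ∀ ρ : ℝ, 0 < ρ → ∀ y : ℝ, g (Real.log ρ + y * I) = ℓ (c + ρ * exp (y * I)) := by
    intro ρ hρ y
    simp [hg, Complex.exp_add, ← Complex.ofReal_exp, Real.exp_log hρ]
  have hre : ((Real.log R : ℂ) + 2 * π * I).re = Real.log R := by simp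
  have him : ((Real.log R : ℂ) + 2 * π * I).im = 2 * π := by simp
  rw [hre, him, ofReal_re, ofReal_im] at key
  have e1 : (∫ x in Real.log r..Real.log R, g (x + ((2 * π : ℝ) : ℂ) * I)) =
      ∫ x in Real.log r..Real.log R, g (x + ((0 : ℝ) : ℂ) * I) := by
    congr 1; ext x
    have := hper x
    push_cast
    rw [this]; simp
  rw [e1, sub_self, zero_add, ← smul_sub] at key
  simp_rw [hcirc R hR, hcirc r hr] at key
  have hn := congrArg norm key
  rw [norm_smul, norm_I, one_mul] at hn
  rw [hn]
  have hinner : ∀ᵐ x : ℝ, x ∈ Ioc (Real.log r) (Real.log R) →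
      ‖∫ y in (0 : ℝ)..2 * π, I • fderiv ℝ g (x + y * I) 1 - fderiv ℝ g (x + y * I) I‖ ≤
        C * Real.exp x * |2 * π - 0| := by
    have hne : ∀ᵐ x : ℝ, x ≠ Real.log R := by
      simp [ae_iff, measure_singleton]
    filter_upwards [hne] with x hx hxm
    have hlt : x < Real.log R := lt_of_le_of_ne hxm.2 hx
    refine intervalIntegral.norm_integral_le_of_norm_le_const_ae ?_
    have hcount : ((fun y : ℝ => (x : ℂ) + y * I) ⁻¹' S).Countable := by
      refine hSc.preimage ?_
      intro y₁ y₂ h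
      have := congrArg Complex.im h
      simpa using this
    have : ∀ᵐ y : ℝ, y ∉ ((fun y : ℝ => (x : ℂ) + y * I) ⁻¹' S) :=
      measure_eq_zero_iff_ae_notMem.1 (hcount.measure_zero volume)
    filter_upwards [this] with y hy _
    simpa using hbound (x + y * I) (by simpa using hlt) hy
  refine (intervalIntegral.norm_integral_le_of_norm_le hlog hinner
    (Continuous.intervalIntegrable (by fun_prop) _ _)).trans (le_of_eq ?_)
  rw [sub_zero, abs_of_pos Real.two_pi_pos]
  rw [intervalIntegral.integral_mul_const, intervalIntegral.integral_const_mul, integral_exp,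
    Real.exp_log hR, Real.exp_log hr]
  ring

open Complex Metric MeasureTheory in
/-- Approximate mean value property of functions with bounded antiholomorphic derivative. -/
theorem norm_integral_circle_sub_center_le {ℓ : ℂ → ℂ} {c : ℂ} {R C : ℝ} {s : Set ℂ}
    (hs : s.Countable) (hR : 0 < R) (hC : 0 ≤ C)
    (hc : ContinuousOn ℓ (closedBall c R))
    (hd : ∀ z ∈ ball c R \ s, DifferentiableAt ℝ ℓ z)
    (hb : ∀ z ∈ ball c R \ s, ‖I * fderiv ℝ ℓ z 1 - fderiv ℝ ℓ z I‖ ≤ C) :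
    ‖(∫ θ in (0 : ℝ)..2 * π, ℓ (c + R * exp (θ * I))) - 2 * π * ℓ c‖ ≤ 2 * π * C * R := by
  refine le_of_forall_pos_le_add fun ε hε => ?_
  have hcc : ContinuousWithinAt ℓ (closedBall c R) c := hc c (mem_closedBall_self hR.le)
  obtain ⟨δ, hδ, hδε⟩ := Metric.continuousWithinAt_iff.1 hcc (ε / (2 * π)) (by positivity)
  set r := min R (δ / 2) with hrdef
  have hr : 0 < r := lt_min hR (by positivity)
  have hrR : r ≤ R := min_le_left _ _
  have hrδ : r < δ := (min_le_right _ _).trans_lt (by linarith)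
  have h1 := norm_integral_circle_sub_le hs hr hrR hC hc hd hb
  have hdist : ∀ θ : ℝ, dist (c + r * exp (θ * I)) c = r := by
    intro θ; simp [abs_of_pos hr]
  have hcont : Continuous fun θ : ℝ => ℓ (c + r * exp (θ * I)) := by
    refine hc.comp_continuous (by fun_prop) fun θ => ?_
    rw [mem_closedBall, hdist]; exact hrR
  have h2 : ‖(∫ θ in (0 : ℝ)..2 * π, ℓ (c + r * exp (θ * I))) - 2 * π * ℓ c‖ ≤ ε := by
    have e : (2 * π * ℓ c : ℂ) = ∫ θ in (0 : ℝ)..2 * π, ℓ c := by simp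
    rw [e, ← intervalIntegral.integral_sub (hcont.intervalIntegrable _ _) (by simp)]
    refine (intervalIntegral.norm_integral_le_of_norm_le_const (C := ε / (2 * π)) ?_).trans ?_
    · intro θ _
      rw [← dist_eq_norm]
      refine (hδε ?_ ?_).le
      · rw [mem_closedBall, hdist]; exact hrR
      · rw [hdist]; exact hrδ
    · rw [sub_zero, abs_of_pos Real.two_pi_pos]
      field_simp; rfl
  calc _ ≤ _ := norm_sub_le_norm_sub_add_norm_sub _ (∫ θ in (0 : ℝ)..2 * π, ℓ (c + r * exp (θ * I))) _
    _ ≤ 2 * π * C * (R - r) + ε := add_le_add h1 h2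
    _ ≤ 2 * π * C * R + ε := by
      have : 0 ≤ 2 * π * C * r := by positivity
      linarith

open Complex Metric in
theorem isSimplyConnected_ball (c : ℂ) {R : ℝ} (hR : 0 < R) : IsSimplyConnected (ball c R) := by
  have : ContractibleSpace (ball c R) := (convex_ball c R).contractibleSpace (nonempty_ball.2 hR)
  exact (inferInstance : SimplyConnectedSpace (ball c R))

open Complex Metric Topology in
/-- A continuous logarithm of a real differentiable function is real differentiable. -/
theorem hasFDerivAt_of_exp_eq {ℓ G : ℂ → ℂ} {z : ℂ} {U : Set ℂ} (hU : U ∈ 𝓝 z)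
    (hℓ : ContinuousAt ℓ z) (h : ∀ x ∈ U, exp (ℓ x) = G x) {L : ℂ →L[ℝ] ℂ}
    (hG : HasFDerivAt G L z) : HasFDerivAt ℓ ((G z)⁻¹ • L) z := by
  have hz : G z ≠ 0 := by
    rw [← h z (mem_of_mem_nhds hU)]; exact exp_ne_zero _
  have h1 : HasFDerivAt (fun x => ℓ z + Complex.log (G x / G z)) ((G z)⁻¹ • L) z := by
    have h2 : HasFDerivAt (fun x => G x / G z) ((G z)⁻¹ • L) z := by
      simpa [div_eq_inv_mul] using hG.const_mul (G z)⁻¹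
    have h3 : HasFDerivAt Complex.log
        ((ContinuousLinearMap.toSpanSingleton ℂ (1 : ℂ)).restrictScalars ℝ) (G z / G z) := by
      have := (Complex.hasDerivAt_log (z := G z / G z) (by rw [div_self hz]; simp)).hasFDerivAt.restrictScalars ℝ
      rw [div_self hz] at this ⊢
      simpa using this
    have h4 := (h3.comp z h2).const_add (ℓ z)
    have e : (G z)⁻¹ • L = ((ContinuousLinearMap.toSpanSingleton ℂ (1 : ℂ)).restrictScalars ℝ).comp
        ((G z)⁻¹ • L) := by
      ext x; simp
    rw [e]
    exact h4
  refine h1.congr_of_eventuallyEq ?_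
  have h5 : ∀ᶠ x in 𝓝 z, ‖ℓ x - ℓ z‖ < π := by
    have : ContinuousAt (fun x => ‖ℓ x - ℓ z‖) z := (hℓ.sub continuousAt_const).norm
    exact this.eventually_lt continuousAt_const (by simpa using Real.pi_pos)
  filter_upwards [h5, hU] with x hx hxU
  rw [← h x hxU, ← h z (mem_of_mem_nhds hU), ← Complex.exp_sub, Complex.log_exp]
  · ring
  · have := (abs_le.1 (abs_im_le_norm (ℓ x - ℓ z))).1; linarith
  · have := (abs_le.1 (abs_im_le_norm (ℓ x - ℓ z))).2; linarith

open Complex Metric MeasureTheory in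
/-- Approximate mean value property of `log ‖G‖` for zero-free generalized analytic functions. -/
theorem abs_integral_log_norm_sub_le {G : ℂ → ℂ} {c : ℂ} {R R' C : ℝ} {s : Set ℂ}
    (hs : s.Countable) (hR : 0 < R) (hRR : R < R') (hC : 0 ≤ C)
    (hc : ContinuousOn G (ball c R')) (hne : ∀ z ∈ ball c R', G z ≠ 0)
    (hd : ∀ z ∈ ball c R' \ s, DifferentiableAt ℝ G z)
    (hb : ∀ z ∈ ball c R' \ s, ‖I * fderiv ℝ G z 1 - fderiv ℝ G z I‖ ≤ C * ‖G z‖) :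
    |(∫ θ in (0 : ℝ)..2 * π, Real.log ‖G (c + R * exp (θ * I))‖) - 2 * π * Real.log ‖G c‖|
      ≤ 2 * π * C * R := by
  obtain ⟨ℓ, hℓc, hℓ⟩ := exists_continuousOn_eqOn_exp_comp
    (isSimplyConnected_ball c (hR.trans hRR)) isOpen_ball hc
    (by rintro ⟨z, hz, h0⟩; exact hne z hz h0)
  have hre : ∀ z ∈ ball c R', Real.log ‖G z‖ = (ℓ z).re := by
    intro z hz
    rw [← hℓ hz, Function.comp_apply, Complex.norm_exp, Real.log_exp]
  have hfd : ∀ z ∈ ball c R' \ s, HasFDerivAt ℓ ((G z)⁻¹ • fderiv ℝ G z) z := fun z hz =>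
    hasFDerivAt_of_exp_eq (isOpen_ball.mem_nhds hz.1)
      (hℓc.continuousAt (isOpen_ball.mem_nhds hz.1)) (fun x hx => hℓ hx) (hd z hz).hasFDerivAt
  have hsub : ∀ z ∈ ball c R \ s, z ∈ ball c R' \ s := fun z hz =>
    ⟨ball_subset_ball hRR.le hz.1, hz.2⟩
  have hcl : ContinuousOn ℓ (closedBall c R) := hℓc.mono (closedBall_subset_ball hRR)
  have key := norm_integral_circle_sub_center_le (ℓ := ℓ) (C := C) hs hR hC hcl
    (fun z hz => (hfd z (hsub z hz)).differentiableAt) ?_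
  · have hmem : ∀ θ : ℝ, c + R * exp (θ * I) ∈ closedBall c R := by
      intro θ; simp [abs_of_pos hR]
    have hcont : Continuous fun θ : ℝ => ℓ (c + R * exp (θ * I)) :=
      hcl.comp_continuous (by fun_prop) hmem
    have e1 : (∫ θ in (0 : ℝ)..2 * π, Real.log ‖G (c + R * exp (θ * I))‖) =
        (∫ θ in (0 : ℝ)..2 * π, ℓ (c + R * exp (θ * I))).re := by
      have := intervalIntegral.intervalIntegral_re (𝕜 := ℂ) (hcont.intervalIntegrable (μ := volume) 0 (2 * π))
      simp only [RCLike.re_to_complex] at this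
      rw [← this]
      congr 1; ext θ
      exact hre _ (closedBall_subset_ball hRR (hmem θ))
    rw [e1, hre c (mem_ball_self (hR.trans hRR))]
    have e2 : (∫ θ in (0 : ℝ)..2 * π, ℓ (c + R * exp (θ * I))).re - 2 * π * (ℓ c).re =
        ((∫ θ in (0 : ℝ)..2 * π, ℓ (c + R * exp (θ * I))) - 2 * π * ℓ c).re := by
      rw [sub_re]
      have : (2 * π * ℓ c : ℂ) = ((2 * π : ℝ) : ℂ) * ℓ c := by push_cast; ring
      rw [this, re_ofReal_mul]
    rw [e2]
    exact (abs_re_le_norm _).trans key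
  · intro z hz
    have hG := hne z (hsub z hz).1
    rw [(hfd z (hsub z hz)).fderiv]
    have : I * ((G z)⁻¹ • fderiv ℝ G z) 1 - ((G z)⁻¹ • fderiv ℝ G z) I =
        (G z)⁻¹ * (I * fderiv ℝ G z 1 - fderiv ℝ G z I) := by
      simp; ring
    rw [this, norm_mul, norm_inv, inv_mul_le_iff₀ (norm_pos_iff.2 hG), mul_comm _ C]
    exact hb z (hsub z hz)

open Complex Metric MeasureTheory in
/-- Integration over a disc in polar coordinates. -/
theorem setIntegral_ball_eq_polar {u : ℂ → ℝ} {c : ℂ} {R : ℝ} (hR : 0 < R)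
    (hu : ContinuousOn u (closedBall c R)) :
    ∫ z in ball c R, u z =
      ∫ r in (0 : ℝ)..R, r * ∫ θ in (0 : ℝ)..2 * π, u (c + r * exp (θ * I)) := by
  have h1 : ∫ z in ball c R, u z = ∫ z, (ball (0 : ℂ) R).indicator (fun z => u (c + z)) z := by
    rw [← integral_indicator measurableSet_ball,
      ← integral_add_left_eq_self ((ball c R).indicator u) c]
    congr 1; ext z
    by_cases hz : z ∈ ball (0 : ℂ) R
    · rw [indicator_of_mem hz, indicator_of_mem]
      simpa using hz
    · rw [indicator_of_notMem hz, indicator_of_notMem]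
      simpa using hz
  have hcm : ContinuousOn (fun p : ℝ × ℝ => p.1 * u (c + p.1 * exp (p.2 * I)))
      (Icc 0 R ×ˢ Icc (-π) π) := by
    refine continuousOn_fst.mul (hu.comp (by fun_prop) ?_)
    intro p hp
    simp [abs_of_nonneg hp.1.1, hp.1.2]
  rw [h1, ← Complex.integral_comp_polarCoord_symm]
  have h2 : ∀ p ∈ polarCoord.target,
      p.1 • (ball (0 : ℂ) R).indicator (fun z => u (c + z)) (Complex.polarCoord.symm p) =
      (Ioo 0 R ×ˢ Ioo (-π) π).indicator (fun p : ℝ × ℝ => p.1 * u (c + p.1 * exp (p.2 * I))) p := by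
    intro p hp
    have hp1 : 0 < p.1 := hp.1
    have e : (Complex.polarCoord.symm p : ℂ) = p.1 * exp (p.2 * I) := by
      rw [Complex.polarCoord_symm_apply, Complex.exp_mul_I]; simp
    rw [e]
    by_cases hpR : p.1 < R
    · rw [indicator_of_mem, indicator_of_mem]
      · rfl
      · exact ⟨⟨hp1, hpR⟩, hp.2⟩
      · simpa [abs_of_pos hp1] using hpR
    · rw [indicator_of_notMem, indicator_of_notMem]
      · simp
      · exact fun h => hpR h.1.2
      · simpa [abs_of_pos hp1] using hpR
  rw [setIntegral_congr_fun polarCoord.open_target.measurableSet h2,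
    setIntegral_indicator (measurableSet_Ioo.prod measurableSet_Ioo)]
  have h3 : polarCoord.target ∩ Ioo 0 R ×ˢ Ioo (-π) π = Ioo 0 R ×ˢ Ioo (-π) π := by
    rw [inter_eq_right]
    exact fun p hp => ⟨hp.1.1, hp.2⟩
  rw [h3, Measure.volume_eq_prod, setIntegral_prod]
  · rw [intervalIntegral.integral_of_le hR.le, integral_Ioc_eq_integral_Ioo]
    refine setIntegral_congr_fun measurableSet_Ioo fun r _ => ?_
    simp only
    rw [integral_const_mul, ← integral_Ioc_eq_integral_Ioo,
      ← intervalIntegral.integral_of_le (by linarith [Real.pi_pos])]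
    congr 1
    have hper : Function.Periodic (fun θ : ℝ => u (c + r * exp (θ * I))) (2 * π) := by
      intro θ
      have : exp (((θ + 2 * π : ℝ) : ℂ) * I) = exp (θ * I) := by
        push_cast; rw [add_mul, Complex.exp_add]; simp
      simp only [this]
    have := hper.intervalIntegral_add_eq (-π) 0
    rw [zero_add] at this
    rw [← this]; congr 1; ring
  · rw [← Measure.volume_eq_prod]
    exact (hcm.integrableOn_compact (isCompact_Icc.prod isCompact_Icc)).mono_set
      (prod_mono Ioo_subset_Icc_self Ioo_subset_Icc_self)

open Complex Metric MeasureTheory in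
theorem abs_setIntegral_ball_sub_le {u : ℂ → ℝ} {c : ℂ} {R C : ℝ} (hR : 0 < R)
    (hu : ContinuousOn u (closedBall c R))
    (hm : ∀ r, 0 < r → r ≤ R →
      |(∫ θ in (0 : ℝ)..2 * π, u (c + r * exp (θ * I))) - 2 * π * u c| ≤ 2 * π * C) :
    |(∫ z in ball c R, u z) - π * R ^ 2 * u c| ≤ π * R ^ 2 * (2 * C) := by
  have hg : Continuous (fun r : ℝ => ∫ θ in (0 : ℝ)..2 * π,
      u (c + (max 0 (min r R) : ℝ) * exp (θ * I))) := by
    refine intervalIntegral.continuous_parametric_intervalIntegral_of_continuous' ?_ _ _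
    refine hu.comp_continuous (by fun_prop) fun p => ?_
    have h0 : 0 ≤ max 0 (min p.1 R) := le_max_left _ _
    have h1 : max 0 (min p.1 R) ≤ R := max_le hR.le (min_le_right _ _)
    rw [mem_closedBall, dist_eq_norm, add_sub_cancel_left, norm_mul, norm_exp_ofReal_mul_I,
      mul_one, norm_real, Real.norm_of_nonneg h0]
    exact h1
  have hcl : ∀ r ∈ uIcc 0 R, max 0 (min r R) = r := by
    intro r hr
    rw [uIcc_of_le hR.le] at hr
    rw [min_eq_left hr.2, max_eq_right hr.1]
  have hcont : ContinuousOn (fun r : ℝ => ∫ θ in (0 : ℝ)..2 * π, u (c + r * exp (θ * I)))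
      (uIcc 0 R) := by
    refine hg.continuousOn.congr fun r hr => ?_
    simp only [hcl r hr]
  have hpol : π * R ^ 2 * u c = ∫ r in (0 : ℝ)..R, r * (2 * π * u c) := by
    rw [intervalIntegral.integral_mul_const, integral_id]; ring
  have hint : IntervalIntegrable (fun r : ℝ => r * ∫ θ in (0 : ℝ)..2 * π, u (c + r * exp (θ * I)))
      volume 0 R := ContinuousOn.intervalIntegrable (continuousOn_id.mul hcont)
  rw [setIntegral_ball_eq_polar hR hu, hpol, ← intervalIntegral.integral_sub hint
    (Continuous.intervalIntegrable (by fun_prop) _ _)]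
  have := intervalIntegral.norm_integral_le_of_norm_le_const (a := 0) (b := R)
    (C := R * (2 * π * C)) (f := fun r : ℝ =>
      r * (∫ θ in (0 : ℝ)..2 * π, u (c + r * exp (θ * I))) - r * (2 * π * u c)) ?_
  · rw [Real.norm_eq_abs, sub_zero, abs_of_pos hR] at this
    refine this.trans (le_of_eq (by ring))
  · intro r hr
    rw [uIoc_of_le hR.le] at hr
    rw [← mul_sub, norm_mul, Real.norm_eq_abs, Real.norm_eq_abs, abs_of_pos hr.1]
    exact mul_le_mul hr.2 (hm r hr.1 hr.2) (abs_nonneg _) hR.le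

open Complex Metric MeasureTheory in
/-- Harnack inequality for zero-free generalized analytic functions. -/
theorem norm_pow_four_le_of_zeroFree {G : ℂ → ℂ} {x z : ℂ} {ρ C M : ℝ} {s : Set ℂ}
    (hs : s.Countable) (hρ : 0 < ρ) (hC : 0 ≤ C)
    (hc : ContinuousOn G (ball x (4 * ρ))) (hne : ∀ z ∈ ball x (4 * ρ), G z ≠ 0)
    (hd : ∀ z ∈ ball x (4 * ρ) \ s, DifferentiableAt ℝ G z)
    (hb : ∀ z ∈ ball x (4 * ρ) \ s, ‖I * fderiv ℝ G z 1 - fderiv ℝ G z I‖ ≤ C * ‖G z‖)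
    (hM : ∀ z ∈ ball x (4 * ρ), ‖G z‖ ≤ M) (hz : z ∈ ball x ρ) :
    ‖G z‖ ^ 4 ≤ M ^ 3 * Real.exp (20 * C * ρ) * ‖G x‖ := by
  have hx4 : x ∈ ball x (4 * ρ) := mem_ball_self (by linarith)
  have hz4 : z ∈ ball x (4 * ρ) := ball_subset_ball (by linarith) hz
  have hM0 : 0 < M := (norm_pos_iff.2 (hne x hx4)).trans_le (hM x hx4)
  set u : ℂ → ℝ := fun w => Real.log M - Real.log ‖G w‖ with hu
  have hu0 : ∀ w ∈ ball x (4 * ρ), 0 ≤ u w := fun w hw =>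
    sub_nonneg.2 (Real.log_le_log (norm_pos_iff.2 (hne w hw)) (hM w hw))
  have huc : ContinuousOn u (ball x (4 * ρ)) :=
    continuousOn_const.sub (hc.norm.log fun w hw => norm_ne_zero_iff.2 (hne w hw))
  have mean : ∀ (y : ℂ) (R : ℝ), 0 < R → closedBall y R ⊆ ball x (4 * ρ) →
      |(∫ w in ball y R, u w) - π * R ^ 2 * u y| ≤ π * R ^ 2 * (2 * (C * R)) := by
    intro y R hR hsub
    refine abs_setIntegral_ball_sub_le hR (huc.mono hsub) fun r hr hrR => ?_
    obtain ⟨R', hR', hsub'⟩ : ∃ R', r < R' ∧ ball y R' ⊆ ball x (4 * ρ) := by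
      obtain ⟨δ, hδ, hsubδ⟩ := (isCompact_closedBall y r).exists_thickening_subset_open isOpen_ball
        ((closedBall_subset_closedBall hrR).trans hsub)
      refine ⟨r + δ, by linarith, ?_⟩
      rwa [thickening_closedBall hδ hr.le, add_comm] at hsubδ
    have key := abs_integral_log_norm_sub_le hs hr hR' hC (hc.mono hsub')
      (fun w hw => hne w (hsub' hw)) (fun w hw => hd w ⟨hsub' hw.1, hw.2⟩)
      (fun w hw => hb w ⟨hsub' hw.1, hw.2⟩)
    have hi : IntervalIntegrable (fun θ : ℝ => Real.log ‖G (y + r * exp (θ * I))‖)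
        volume 0 (2 * π) := by
      refine Continuous.intervalIntegrable ?_ _ _
      have hmem : ∀ θ : ℝ, y + r * exp (θ * I) ∈ ball x (4 * ρ) := fun θ =>
        hsub (closedBall_subset_closedBall hrR (by simp [abs_of_pos hr]))
      exact (hc.norm.log fun w hw => norm_ne_zero_iff.2 (hne w hw)).comp_continuous
        (by fun_prop) hmem
    have e : (∫ θ in (0 : ℝ)..2 * π, u (y + r * exp (θ * I))) - 2 * π * u y =
        -((∫ θ in (0 : ℝ)..2 * π, Real.log ‖G (y + r * exp (θ * I))‖)
          - 2 * π * Real.log ‖G y‖) := by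
      simp only [hu]
      rw [intervalIntegral.integral_sub (by simp) hi]
      simp; ring
    rw [e, abs_neg]
    refine key.trans ?_
    rw [mul_assoc (2 * π)]
    gcongr
  have hzd : dist z x < ρ := hz
  have hsub1 : closedBall z (2 * ρ) ⊆ ball x (4 * ρ) := by
    intro w hw
    have h1 : dist w z ≤ 2 * ρ := hw
    have := dist_triangle w z x
    rw [mem_ball]; linarith
  have hsub2 : ball x ρ ⊆ ball z (2 * ρ) := by
    intro w hw
    have h1 : dist w x < ρ := hw
    have := dist_triangle_right w z x
    rw [mem_ball]; linarith
  have m1 := abs_le.1 (mean z (2 * ρ) (by linarith) hsub1)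
  have m2 := abs_le.1 (mean x ρ hρ (closedBall_subset_ball (by linarith)))
  have mono : ∫ w in ball x ρ, u w ≤ ∫ w in ball z (2 * ρ), u w := by
    refine setIntegral_mono_set ?_ ?_ (Filter.Eventually.of_forall hsub2)
    · exact ((huc.mono hsub1).integrableOn_compact (isCompact_closedBall _ _)).mono_set
        ball_subset_closedBall
    · exact (ae_restrict_iff' measurableSet_ball).2
        (Filter.Eventually.of_forall fun w hw => hu0 w (hsub1 (ball_subset_closedBall hw)))
  have hA : 0 < π * ρ ^ 2 := by positivity
  have hfin : u x ≤ 4 * u z + 20 * C * ρ := by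
    have h3 : π * ρ ^ 2 * u x - π * ρ ^ 2 * (2 * (C * ρ)) ≤
        π * (2 * ρ) ^ 2 * u z + π * (2 * ρ) ^ 2 * (2 * (C * (2 * ρ))) := by linarith [m1.2, m2.1]
    have h4 : π * ρ ^ 2 * u x ≤ π * ρ ^ 2 * (4 * u z + 18 * C * ρ) := by linarith
    have h5 := le_of_mul_le_mul_left h4 hA
    nlinarith [mul_nonneg hC hρ.le]
  have hGx := norm_pos_iff.2 (hne x hx4)
  have hGz := norm_pos_iff.2 (hne z hz4)
  rw [← Real.log_le_log_iff (by positivity) (by positivity), Real.log_mul (by positivity)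
    (by positivity), Real.log_mul (by positivity) (by positivity), Real.log_exp, Real.log_pow,
    Real.log_pow]
  simp only [hu] at hfin
  push_cast
  linarith

open Complex ComplexConjugate in
/-- The real linear map `x ↦ α x + β x̄`. -/
noncomputable def wirt (α β : ℂ) : ℂ →L[ℝ] ℂ :=
  α • ContinuousLinearMap.id ℝ ℂ + β • (conjCLE : ℂ →L[ℝ] ℂ)

open Complex ComplexConjugate in
theorem wirt_apply (α β x : ℂ) : wirt α β x = α * x + β * conj x := by simp [wirt]

open Complex ComplexConjugate in
theorem wirt_comp (α β γ δ : ℂ) :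
    (wirt α β).comp (wirt γ δ) = wirt (α * γ + β * conj δ) (α * δ + β * conj γ) := by
  ext x; simp [wirt_apply]; ring

open Complex ComplexConjugate in
theorem smul_wirt (c α β : ℂ) : c • wirt α β = wirt (c * α) (c * β) := by
  ext x; simp [wirt_apply]; ring

open Complex ComplexConjugate in
theorem wirt_add (α β γ δ : ℂ) : wirt α β + wirt γ δ = wirt (α + γ) (β + δ) := by
  ext x; simp [wirt_apply]; ring

open Complex ComplexConjugate in
theorem norm_I_mul_wirt_sub (α β : ℂ) : ‖I * wirt α β 1 - wirt α β I‖ = 2 * ‖β‖ := by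
  have : I * wirt α β 1 - wirt α β I = 2 * (I * β) := by simp [wirt_apply]; ring
  rw [this]; simp

theorem _root_.HasDerivAt.hasFDerivAt_wirt {f : ℂ → ℂ} {f' z : ℂ} (h : HasDerivAt f f' z) :
    HasFDerivAt f (wirt f' 0) z := by
  have e : wirt f' 0 = (ContinuousLinearMap.toSpanSingleton ℂ f').restrictScalars ℝ := by
    ext x; simp [wirt_apply, mul_comm]
  rw [e]
  exact h.hasFDerivAt.restrictScalars ℝ

open Complex ComplexConjugate Metric in
/-- The Gauss map `q` of a minimal graph (a solution of the Beltrami equation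
`q_w̄ = -q̄² q_w`) together with a harmonic parametrization `W` whose dilatation is the square of
the Möbius map `z ↦ (κ + z) / (1 + κ z)`. -/
structure ContactPair (κ : ℝ) (q A W G : ℂ → ℂ) : Prop where
  nonneg : 0 ≤ κ
  lt_one : κ < 1
  norm_q_lt : ∀ w ∈ ball (0 : ℂ) 1, ‖q w‖ < 1
  hasFDerivAt_q : ∀ w ∈ ball (0 : ℂ) 1, HasFDerivAt q (wirt (A w) (-(conj (q w)) ^ 2 * A w)) w
  continuousOn_A : ContinuousOn A (ball 0 1)
  mapsTo_W : MapsTo W (ball 0 1) (ball 0 1)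
  hasFDerivAt_W : ∀ z ∈ ball (0 : ℂ) 1,
    HasFDerivAt W (wirt (G z) (conj (((κ + z) / (1 + κ * z)) ^ 2 * G z))) z
  continuousOn_G : ContinuousOn G (ball 0 1)
  W_zero : W 0 = 0
  q_zero : q 0 = κ

/-- The difference quotient at the origin comparing `q ∘ (t W)` with a Möbius map. -/
noncomputable def contactQuot (κ : ℝ) (q A W G : ℂ → ℂ) (t : ℝ) (z : ℂ) : ℂ :=
  if z = 0 then 1 - κ ^ 2 - t * ((1 - κ ^ 4) * A 0 * G 0)
  else ((κ + z) - q (t * W z) * (1 + κ * z)) / z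

namespace ContactPair

open Complex ComplexConjugate Metric Topology Filter

variable {κ : ℝ} {q A W G : ℂ → ℂ}

theorem smul_mem_ball {t : ℝ} {w : ℂ} (ht : t ∈ Icc (0 : ℝ) 1) (hw : w ∈ ball (0 : ℂ) 1) :
    (t : ℂ) * w ∈ ball (0 : ℂ) 1 := by
  rw [mem_ball_zero_iff] at *
  rw [norm_mul, norm_real, Real.norm_of_nonneg ht.1]
  nlinarith [norm_nonneg w, ht.2]

theorem one_sub_le_norm (h : ContactPair κ q A W G) {z : ℂ} (hz : z ∈ ball (0 : ℂ) 1) :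
    1 - κ ≤ ‖1 + κ * z‖ := by
  rw [mem_ball_zero_iff] at hz
  have := norm_sub_norm_le (1 : ℂ) (-(κ * z))
  rw [sub_neg_eq_add, norm_neg, norm_mul, norm_real, Real.norm_of_nonneg h.nonneg, norm_one] at this
  nlinarith [h.nonneg]

theorem one_add_ne_zero (h : ContactPair κ q A W G) {z : ℂ} (hz : z ∈ ball (0 : ℂ) 1) :
    (1 + κ * z : ℂ) ≠ 0 :=
  norm_pos_iff.1 ((sub_pos.2 h.lt_one).trans_le (h.one_sub_le_norm hz))

theorem normSq_identity (κ : ℝ) (z : ℂ) :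
    ‖1 + κ * z‖ ^ 2 - ‖κ + z‖ ^ 2 = (1 - κ ^ 2) * (1 - ‖z‖ ^ 2) := by
  simp only [Complex.sq_norm, Complex.normSq_apply]
  simp; ring

theorem continuousOn_q (h : ContactPair κ q A W G) : ContinuousOn q (ball 0 1) :=
  fun w hw => (h.hasFDerivAt_q w hw).continuousAt.continuousWithinAt

theorem continuousOn_W (h : ContactPair κ q A W G) : ContinuousOn W (ball 0 1) :=
  fun w hw => (h.hasFDerivAt_W w hw).continuousAt.continuousWithinAt

theorem continuousOn_smul_W (h : ContactPair κ q A W G) :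
    ContinuousOn (fun p : ℝ × ℂ => (p.1 : ℂ) * W p.2) (Icc 0 1 ×ˢ ball 0 1) :=
  (by fun_prop : Continuous fun p : ℝ × ℂ => (p.1 : ℂ)).continuousOn.mul
    (h.continuousOn_W.comp continuousOn_snd fun _ hp => hp.2)

theorem mapsTo_smul_W (h : ContactPair κ q A W G) :
    MapsTo (fun p : ℝ × ℂ => (p.1 : ℂ) * W p.2) (Icc 0 1 ×ˢ ball 0 1) (ball 0 1) :=
  fun _ hp => smul_mem_ball hp.1 (h.mapsTo_W hp.2)

/-- First order expansion at the origin, uniformly in the parameter. -/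
theorem eventually_norm_sub_le (h : ContactPair κ q A W G) {ε : ℝ} (hε : 0 < ε) :
    ∀ᶠ z in 𝓝 (0 : ℂ), ∀ t ∈ Icc (0 : ℝ) 1,
      ‖q (t * W z) - κ - t * ((1 - κ ^ 4) * A 0 * G 0) * z‖ ≤ ε * ‖z‖ := by
  have h0 : (0 : ℂ) ∈ ball (0 : ℂ) 1 := mem_ball_self one_pos
  have hq := h.hasFDerivAt_q 0 h0
  have hW := h.hasFDerivAt_W 0 h0
  set L := wirt (A 0) (-(conj (q 0)) ^ 2 * A 0) with hL
  set M := wirt (G 0) (conj (((κ + 0) / (1 + κ * 0)) ^ 2 * G 0)) with hM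
  have hLM : ∀ z, L (M z) = (1 - κ ^ 4) * A 0 * G 0 * z := by
    intro z
    rw [hL, hM, ← ContinuousLinearMap.comp_apply, wirt_comp, wirt_apply, h.q_zero]
    simp; ring
  set η := ε / (‖L‖ + ‖M‖ + 2) with hη
  have hden : 0 < ‖L‖ + ‖M‖ + 2 := by positivity
  have hη0 : 0 < η := by positivity
  have hq' := hq.isLittleO.def hη0
  have hW1 := hW.isLittleO.def hη0
  have hW2 := hW.isLittleO.def one_pos
  rw [Metric.eventually_nhds_iff] at hq'
  obtain ⟨δ, hδ, hq'⟩ := hq'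
  have hWc : ∀ᶠ z in 𝓝 (0 : ℂ), ‖W z‖ < δ := by
    have := hW.continuousAt.norm
    rw [ContinuousAt, h.W_zero, norm_zero] at this
    exact this.eventually (gt_mem_nhds hδ)
  filter_upwards [hW1, hW2, hWc] with z h1 h2 h3 t ht
  simp only [h.W_zero, sub_zero, one_mul] at h1 h2
  have hWn : ‖W z‖ ≤ (‖M‖ + 1) * ‖z‖ := by
    have := norm_add_le (W z - M z) (M z)
    rw [sub_add_cancel] at this
    nlinarith [M.le_opNorm z]
  have htn : ‖(t : ℂ) * W z‖ ≤ ‖W z‖ := by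
    rw [norm_mul, norm_real, Real.norm_of_nonneg ht.1]
    exact mul_le_of_le_one_left (norm_nonneg _) ht.2
  have h4 := hq' (y := (t : ℂ) * W z) (by rw [dist_zero_right]; linarith)
  simp only [h.q_zero, sub_zero] at h4
  have hLt : L ((t : ℂ) * W z) = t * L (W z) := by
    rw [← real_smul, map_smul, real_smul]
  have e : q (t * W z) - κ - t * ((1 - κ ^ 4) * A 0 * G 0) * z =
      (q (t * W z) - κ - L (t * W z)) + t * L (W z - M z) := by
    rw [hLt, map_sub, hLM]; ring
  rw [e]
  refine (norm_add_le _ _).trans ?_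
  have h5 : ‖(t : ℂ) * L (W z - M z)‖ ≤ ‖L‖ * (η * ‖z‖) := by
    rw [norm_mul, norm_real, Real.norm_of_nonneg ht.1]
    refine (mul_le_of_le_one_left (norm_nonneg _) ht.2).trans ((L.le_opNorm _).trans ?_)
    gcongr
  have h6 : ‖q (t * W z) - κ - L (t * W z)‖ ≤ η * ((‖M‖ + 1) * ‖z‖) :=
    h4.trans (mul_le_mul_of_nonneg_left (htn.trans hWn) hη0.le)
  have h7 : ε = η * (‖L‖ + ‖M‖ + 2) := by rw [hη]; field_simp
  rw [h7]
  nlinarith [mul_nonneg hη0.le (norm_nonneg z)]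

theorem continuousOn_contactQuot (h : ContactPair κ q A W G) :
    ContinuousOn (fun p : ℝ × ℂ => contactQuot κ q A W G p.1 p.2) (Icc 0 1 ×ˢ ball 0 1) := by
  rintro ⟨t₀, z₀⟩ ⟨ht₀, hz₀⟩
  by_cases hz : z₀ = 0
  · subst hz
    set lam := (1 - κ ^ 4) * A 0 * G 0 with hlam
    rw [ContinuousWithinAt]
    simp only [contactQuot, if_true]
    rw [Metric.tendsto_nhds]
    intro ε hε
    have c1 : ∀ᶠ p : ℝ × ℂ in 𝓝 (t₀, 0), ‖(p.1 : ℂ) * lam - t₀ * lam‖ < ε / 3 := by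
      have : Continuous fun p : ℝ × ℂ => ‖(p.1 : ℂ) * lam - t₀ * lam‖ := by fun_prop
      have := this.tendsto (t₀, 0)
      simp only [sub_self, norm_zero] at this
      exact this.eventually (gt_mem_nhds (by positivity))
    have c2 : ∀ᶠ p : ℝ × ℂ in 𝓝 (t₀, 0), ‖(p.1 : ℂ) * lam * κ * p.2‖ < ε / 3 := by
      have : Continuous fun p : ℝ × ℂ => ‖(p.1 : ℂ) * lam * κ * p.2‖ := by fun_prop
      have := this.tendsto (t₀, 0)
      simp only [mul_zero, norm_zero] at this
      exact this.eventually (gt_mem_nhds (by positivity))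
    have c3 : ∀ᶠ p : ℝ × ℂ in 𝓝 (t₀, 0), ∀ t ∈ Icc (0 : ℝ) 1,
        ‖q (t * W p.2) - κ - t * lam * p.2‖ ≤ ε / 6 * ‖p.2‖ :=
      (continuous_snd.tendsto (t₀, (0 : ℂ))).eventually
        (h.eventually_norm_sub_le (ε := ε / 6) (by positivity))
    filter_upwards [nhdsWithin_le_nhds c1, nhdsWithin_le_nhds c2, nhdsWithin_le_nhds c3,
      self_mem_nhdsWithin] with p h1 h2 h3 hp
    have h3 := h3 p.1 hp.1
    rw [dist_eq_norm]
    by_cases hp2 : p.2 = 0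
    · rw [if_pos hp2]
      have e : 1 - (κ : ℂ) ^ 2 - p.1 * lam - (1 - κ ^ 2 - t₀ * lam) =
        -((p.1 : ℂ) * lam - t₀ * lam) := by ring
      rw [e, norm_neg]; linarith
    · rw [if_neg hp2]
      have e : (κ + p.2 - q (p.1 * W p.2) * (1 + κ * p.2)) / p.2 - (1 - κ ^ 2 - t₀ * lam) =
          -((q (p.1 * W p.2) - κ - p.1 * lam * p.2) * (1 + κ * p.2) / p.2)
            - (p.1 * lam * κ * p.2) - ((p.1 : ℂ) * lam - t₀ * lam) := by
        field_simp; ring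
      rw [e]
      have hpz : 0 < ‖p.2‖ := norm_pos_iff.2 hp2
      have hp1 : ‖p.2‖ < 1 := by simpa using hp.2
      have h4 : ‖1 + κ * p.2‖ ≤ 2 := by
        refine (norm_add_le _ _).trans ?_
        rw [norm_one, norm_mul, norm_real, Real.norm_of_nonneg h.nonneg]
        nlinarith [h.lt_one, h.nonneg]
      have h5 : ‖(q (p.1 * W p.2) - κ - p.1 * lam * p.2) * (1 + κ * p.2) / p.2‖ ≤ ε / 3 := by
        rw [norm_div, norm_mul, div_le_iff₀ hpz]
        calc _ ≤ (ε / 6 * ‖p.2‖) * 2 := by gcongr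
          _ = _ := by ring
      refine (norm_sub_le _ _).trans_lt ?_
      have := norm_sub_le (-((q (p.1 * W p.2) - κ - p.1 * lam * p.2) * (1 + κ * p.2) / p.2))
        (p.1 * lam * κ * p.2)
      rw [norm_neg] at this
      linarith
  · have hne : ∀ᶠ p : ℝ × ℂ in 𝓝[Icc 0 1 ×ˢ ball 0 1] (t₀, z₀), p.2 ≠ 0 :=
      nhdsWithin_le_nhds ((continuous_snd.tendsto (t₀, z₀)).eventually (isOpen_ne.mem_nhds hz))
    have hc : ContinuousWithinAt
        (fun p : ℝ × ℂ => ((κ + p.2) - q (p.1 * W p.2) * (1 + κ * p.2)) / p.2)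
        (Icc 0 1 ×ˢ ball 0 1) (t₀, z₀) := by
      have h1 := (h.continuousOn_q.comp h.continuousOn_smul_W h.mapsTo_smul_W) (t₀, z₀) ⟨ht₀, hz₀⟩
      refine ContinuousWithinAt.div ?_ continuousWithinAt_snd hz
      exact (by fun_prop : Continuous fun p : ℝ × ℂ => (κ + p.2 : ℂ)).continuousWithinAt.sub
        (h1.mul (by fun_prop : Continuous fun p : ℝ × ℂ => (1 + κ * p.2 : ℂ)).continuousWithinAt)
    refine hc.congr_of_eventuallyEq ?_ ?_
    · filter_upwards [hne] with p hp
      simp [contactQuot, hp]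
    · simp [contactQuot, hz]

theorem hasFDerivAt_contactQuot (h : ContactPair κ q A W G) {t : ℝ} (ht : t ∈ Icc (0 : ℝ) 1)
    {z : ℂ} (hz : z ∈ ball (0 : ℂ) 1) (hz0 : z ≠ 0) :
    ∃ α β, HasFDerivAt (contactQuot κ q A W G t) (wirt α β) z ∧
      ‖β‖ ≤ 2 * (‖A (t * W z)‖ * ‖G z‖) * ‖contactQuot κ q A W G t z‖ := by
  have hw := smul_mem_ball ht (h.mapsTo_W hz)
  set w := (t : ℂ) * W z with hwdef
  set m := (κ + z) / (1 + κ * z) with hm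
  have hnz := h.one_add_ne_zero hz
  have hW : HasFDerivAt (fun x => (t : ℂ) * W x) (wirt (t * G z) (t * conj (m ^ 2 * G z))) z := by
    rw [← smul_wirt]
    exact (h.hasFDerivAt_W z hz).const_mul (t : ℂ)
  have hq := (h.hasFDerivAt_q w hw).comp z hW
  rw [wirt_comp] at hq
  have h1 : HasFDerivAt (fun x : ℂ => (κ + x) / x) (wirt (-κ / z ^ 2) 0) z := by
    refine HasDerivAt.hasFDerivAt_wirt ?_
    exact (((hasDerivAt_id z).const_add (κ : ℂ)).div (hasDerivAt_id z) hz0).congr_deriv (by simp)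
  have h2 : HasFDerivAt (fun x : ℂ => (1 + κ * x) / x) (wirt (-1 / z ^ 2) 0) z := by
    refine HasDerivAt.hasFDerivAt_wirt ?_
    exact ((((hasDerivAt_id z).const_mul (κ : ℂ)).const_add 1).div (hasDerivAt_id z)
      hz0).congr_deriv (by simp)
  have h3 := h1.sub (hq.mul h2)
  have hE : contactQuot κ q A W G t =ᶠ[𝓝 z]
      fun x => (κ + x) / x - (q ∘ fun x => (t : ℂ) * W x) x * ((1 + κ * x) / x) := by
    filter_upwards [isOpen_ne.mem_nhds hz0] with x hx
    have hx : x ≠ 0 := hx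
    simp only [contactQuot, hx, if_false, Function.comp]
    field_simp
  have hEz : contactQuot κ q A W G t z = (1 + κ * z) / z * (m - q w) := by
    rw [hE.self_of_nhds, hm]
    simp only [Function.comp, ← hwdef]
    field_simp
  have h4 := h3.congr_of_eventuallyEq hE
  rw [smul_wirt, smul_wirt, wirt_add, sub_eq_add_neg, ← neg_one_smul ℂ (wirt _ _), smul_wirt,
    wirt_add] at h4
  refine ⟨_, _, h4, ?_⟩
  have hβ : ∀ β, β = -((1 + κ * z) / z * (t * A w * conj (G z) * (conj m - conj (q w))
      * (conj m + conj (q w)))) →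
      ‖β‖ ≤ 2 * (‖A w‖ * ‖G z‖) * ‖contactQuot κ q A W G t z‖ := by
    rintro β rfl
    have hm1 : ‖m‖ ≤ 1 := by
      rw [hm, norm_div, div_le_one (norm_pos_iff.2 hnz)]
      have := normSq_identity κ z
      rw [mem_ball_zero_iff] at hz
      have h5 : 0 ≤ (1 - κ ^ 2) * (1 - ‖z‖ ^ 2) :=
        mul_nonneg (by nlinarith [h.lt_one, h.nonneg]) (by nlinarith [norm_nonneg z])
      exact (sq_le_sq₀ (norm_nonneg _) (norm_nonneg _)).1 (by linarith)
    have h5 : ‖conj m - conj (q w)‖ = ‖m - q w‖ := by rw [← map_sub, norm_conj]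
    have h6 : ‖conj m + conj (q w)‖ ≤ 2 := by
      rw [← map_add, norm_conj]
      exact (norm_add_le _ _).trans (by linarith [h.norm_q_lt w hw])
    rw [hEz, norm_neg, norm_mul, norm_mul, norm_mul, norm_mul, norm_mul, norm_conj, h5, norm_real,
      Real.norm_of_nonneg ht.1, norm_mul]
    have h7 : t * ‖conj m + conj (q w)‖ ≤ 2 := by nlinarith [ht.1, ht.2, norm_nonneg (conj m + conj (q w))]
    calc _ = (‖A w‖ * ‖G z‖) * (‖(1 + κ * z) / z‖ * ‖m - q w‖) * (t * ‖conj m + conj (q w)‖) := by ring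
      _ ≤ (‖A w‖ * ‖G z‖) * (‖(1 + κ * z) / z‖ * ‖m - q w‖) * 2 := by gcongr
      _ = _ := by ring
  refine hβ _ ?_
  simp only [map_mul, map_pow, conj_ofReal, mul_zero, zero_add]
  ring

/-- For `t ≤ t' < 1` the zeros stay in a compact part of the disc. -/
theorem isCompact_zeros (h : ContactPair κ q A W G) {t' : ℝ} (h0 : 0 ≤ t') (h1 : t' < 1) :
    IsCompact {t ∈ Icc 0 t' | ∃ z ∈ ball (0 : ℂ) 1, contactQuot κ q A W G t z = 0} := by
  have hsub : closedBall (0 : ℂ) t' ⊆ ball 0 1 := closedBall_subset_ball h1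
  obtain ⟨w₀, hw₀, hmax⟩ := (isCompact_closedBall (0 : ℂ) t').exists_isMaxOn
    ⟨0, mem_closedBall_self h0⟩ (h.continuousOn_q.mono hsub).norm
  have hk1 := h.norm_q_lt w₀ (hsub hw₀)
  set k := ‖q w₀‖ with hk
  have hk0 : 0 ≤ k := norm_nonneg _
  have hκ := h.nonneg
  have hκ1 := h.lt_one
  set c := (1 - k ^ 2) * (1 - κ) ^ 2 with hc
  have hc0 : 0 < c := mul_pos (by nlinarith) (by nlinarith)
  have hr1 : √(1 - c) < 1 := by
    rw [Real.sqrt_lt' one_pos]; linarith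
  have hrsub : closedBall (0 : ℂ) √(1 - c) ⊆ ball 0 1 := closedBall_subset_ball hr1
  have hprod : Icc 0 t' ×ˢ closedBall (0 : ℂ) √(1 - c) ⊆ Icc 0 1 ×ˢ ball 0 1 :=
    prod_mono (Icc_subset_Icc le_rfl h1.le) hrsub
  have hcomp : IsCompact (Icc 0 t' ×ˢ closedBall (0 : ℂ) √(1 - c)) :=
    isCompact_Icc.prod (isCompact_closedBall _ _)
  have hZ : IsCompact (Icc 0 t' ×ˢ closedBall (0 : ℂ) √(1 - c) ∩
      (fun p : ℝ × ℂ => contactQuot κ q A W G p.1 p.2) ⁻¹' {0}) :=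
    hcomp.of_isClosed_subset ((h.continuousOn_contactQuot.mono hprod).preimage_isClosed_of_isClosed
      hcomp.isClosed isClosed_singleton) inter_subset_left
  convert hZ.image continuous_fst using 1
  ext t
  constructor
  · rintro ⟨ht, z, hz, hE⟩
    refine ⟨(t, z), ⟨⟨ht, ?_⟩, hE⟩, rfl⟩
    rw [mem_closedBall_zero_iff]
    by_cases hz0 : z = 0
    · rw [hz0, norm_zero]; positivity
    simp only [contactQuot, hz0, if_false, div_eq_zero_iff, or_false, sub_eq_zero] at hE
    have hz1 : ‖z‖ < 1 := by simpa using hz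
    have hwt : (t : ℂ) * W z ∈ closedBall (0 : ℂ) t' := by
      have := h.mapsTo_W hz
      rw [mem_ball_zero_iff] at this
      rw [mem_closedBall_zero_iff, norm_mul, norm_real, Real.norm_of_nonneg ht.1]
      nlinarith [ht.1, ht.2, norm_nonneg (W z)]
    have hqk : ‖q (t * W z)‖ ≤ k := hmax hwt
    have hn : ‖κ + z‖ ≤ k * ‖1 + κ * z‖ := by
      rw [hE, norm_mul]; gcongr
    have hid := normSq_identity κ z
    have h5 := h.one_sub_le_norm hz
    have h6 : ‖κ + z‖ ^ 2 ≤ k ^ 2 * ‖1 + κ * z‖ ^ 2 := by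
      rw [← mul_pow]; gcongr
    have h7 : c ≤ (1 - k ^ 2) * ‖1 + κ * z‖ ^ 2 := by
      rw [hc]
      have h1k : 0 ≤ 1 - k ^ 2 := by nlinarith
      have h1κ : 0 ≤ 1 - κ := by linarith
      gcongr
    refine Real.le_sqrt_of_sq_le ?_
    have h8 : 0 ≤ κ ^ 2 * (1 - ‖z‖ ^ 2) := mul_nonneg (sq_nonneg _) (by nlinarith [norm_nonneg z])
    nlinarith
  · rintro ⟨⟨t, z⟩, ⟨⟨ht, hz⟩, hE⟩, rfl⟩
    exact ⟨ht, z, hrsub hz, hE⟩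

/-- At the first parameter at which a zero appears, the zero set is open. -/
theorem eventually_eq_zero (h : ContactPair κ q A W G) {t₁ : ℝ} (ht₁ : 0 < t₁) (ht₁' : t₁ ≤ 1)
    (hfree : ∀ t ∈ Ico 0 t₁, ∀ z ∈ ball (0 : ℂ) 1, contactQuot κ q A W G t z ≠ 0)
    {x : ℂ} (hx : x ∈ ball (0 : ℂ) 1) (hEx : contactQuot κ q A W G t₁ x = 0) :
    ∀ᶠ z in 𝓝 x, contactQuot κ q A W G t₁ z = 0 := by
  obtain ⟨ε, hε, hsub⟩ := Metric.nhds_basis_closedBall.mem_iff.1 (isOpen_ball.mem_nhds hx)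
  set ρ := ε / 4 with hρdef
  have hρ : 0 < ρ := by positivity
  have h4 : 4 * ρ = ε := by rw [hρdef]; ring
  have hprod : Icc 0 1 ×ˢ closedBall x ε ⊆ Icc (0 : ℝ) 1 ×ˢ ball (0 : ℂ) 1 :=
    prod_mono le_rfl hsub
  have hcomp : IsCompact (Icc (0 : ℝ) 1 ×ˢ closedBall x ε) :=
    isCompact_Icc.prod (isCompact_closedBall _ _)
  obtain ⟨M, hM⟩ := hcomp.exists_bound_of_continuousOn (h.continuousOn_contactQuot.mono hprod)
  have hAG : ContinuousOn (fun p : ℝ × ℂ => ‖A (p.1 * W p.2)‖ * ‖G p.2‖)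
      (Icc (0 : ℝ) 1 ×ˢ ball (0 : ℂ) 1) :=
    (h.continuousOn_A.comp h.continuousOn_smul_W h.mapsTo_smul_W).norm.mul
      (h.continuousOn_G.comp continuousOn_snd fun _ hp => hp.2).norm
  obtain ⟨B, hB⟩ := hcomp.exists_bound_of_continuousOn (hAG.mono hprod)
  have hB0 : 0 ≤ B := (norm_nonneg _).trans (hB (0, x)
    ⟨⟨le_rfl, zero_le_one⟩, mem_closedBall_self hε.le⟩)
  have hslice : ∀ z ∈ ball (0 : ℂ) 1,
      Tendsto (fun t => ‖contactQuot κ q A W G t z‖) (𝓝[Ico 0 t₁] t₁)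
        (𝓝 ‖contactQuot κ q A W G t₁ z‖) := by
    intro z hz
    have h1 : ContinuousOn (fun t => contactQuot κ q A W G t z) (Icc 0 1) :=
      h.continuousOn_contactQuot.comp (f := fun t => (t, z)) (by fun_prop) fun t ht => ⟨ht, hz⟩
    exact ((h1.norm t₁ ⟨ht₁.le, ht₁'⟩).mono fun t ht => ⟨ht.1, ht.2.le.trans ht₁'⟩)
  have hne : (𝓝[Ico 0 t₁] t₁).NeBot :=
    mem_closure_iff_nhdsWithin_neBot.1 (by rw [closure_Ico ht₁.ne]; exact ⟨ht₁.le, le_rfl⟩)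
  filter_upwards [ball_mem_nhds x hρ] with z hz
  have hzD : z ∈ ball (0 : ℂ) 1 :=
    hsub (ball_subset_closedBall (ball_subset_ball (by linarith) hz))
  have hle : ‖contactQuot κ q A W G t₁ z‖ ^ 4 ≤
      M ^ 3 * Real.exp (20 * (4 * B) * ρ) * ‖contactQuot κ q A W G t₁ x‖ := by
    refine le_of_tendsto_of_tendsto ((hslice z hzD).pow 4) ((hslice x hx).const_mul _) ?_
    filter_upwards [self_mem_nhdsWithin] with t ht
    have htI : t ∈ Icc (0 : ℝ) 1 := ⟨ht.1, ht.2.le.trans ht₁'⟩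
    have hcb : ∀ y ∈ ball x (4 * ρ), y ∈ closedBall x ε := fun y hy =>
      ball_subset_closedBall (by rwa [h4] at hy)
    refine norm_pow_four_le_of_zeroFree (s := {0}) (countable_singleton 0) hρ (by positivity)
      ?_ (fun y hy => hfree t ht y (hsub (hcb y hy))) ?_ ?_ (fun y hy => hM (t, y) ⟨htI, hcb y hy⟩)
      hz
    · exact h.continuousOn_contactQuot.comp (f := fun z => (t, z)) (by fun_prop)
        fun y hy => ⟨htI, hsub (hcb y hy)⟩
    · intro y hy
      obtain ⟨α, β, hd, -⟩ := h.hasFDerivAt_contactQuot htI (hsub (hcb y hy.1)) hy.2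
      exact hd.differentiableAt
    · intro y hy
      obtain ⟨α, β, hd, hb⟩ := h.hasFDerivAt_contactQuot htI (hsub (hcb y hy.1)) hy.2
      rw [hd.fderiv, norm_I_mul_wirt_sub]
      have := hB (t, y) ⟨htI, hcb y hy.1⟩
      rw [Real.norm_of_nonneg (by positivity)] at this
      calc 2 * ‖β‖ ≤ 2 * (2 * (‖A (t * W y)‖ * ‖G y‖) * ‖contactQuot κ q A W G t y‖) := by gcongr
        _ ≤ 2 * (2 * B * ‖contactQuot κ q A W G t y‖) := by gcongr
        _ = _ := by ring
  rw [hEx, norm_zero, mul_zero] at hle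
  exact norm_eq_zero.1 (pow_eq_zero_iff (by norm_num)|>.1 (le_antisymm hle (by positivity)))

theorem contactQuot_zero_ne (h : ContactPair κ q A W G) (z : ℂ) :
    contactQuot κ q A W G 0 z ≠ 0 := by
  have h1 : (1 - κ ^ 2 : ℂ) ≠ 0 := by
    have : (1 - κ ^ 2 : ℝ) ≠ 0 := by nlinarith [h.nonneg, h.lt_one]
    exact_mod_cast this
  by_cases hz : z = 0
  · simpa [contactQuot, hz] using h1
  · simp only [contactQuot, hz, if_false, ofReal_zero, zero_mul, h.q_zero]
    convert h1 using 1
    field_simp; ring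

/-- If `W` has a radial limit inside the disc, no zero ever appears. -/
theorem contactQuot_ne_zero (h : ContactPair κ q A W G) {w₁ : ℂ} (hw₁ : w₁ ∈ ball (0 : ℂ) 1)
    (hlim : Tendsto (fun x : ℝ => W x) (𝓝[<] 1) (𝓝 w₁)) {t : ℝ} (ht : t ∈ Icc (0 : ℝ) 1)
    {z : ℂ} (hz : z ∈ ball (0 : ℂ) 1) : contactQuot κ q A W G t z ≠ 0 := by
  intro hE
  obtain ⟨t₁, ht₁, ⟨x, hx, hEx⟩, hfree⟩ : ∃ t₁ ∈ Icc (0 : ℝ) 1,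
      (∃ z ∈ ball (0 : ℂ) 1, contactQuot κ q A W G t₁ z = 0) ∧
      ∀ t ∈ Ico 0 t₁, ∀ z ∈ ball (0 : ℂ) 1, contactQuot κ q A W G t z ≠ 0 := by
    by_cases hcase : ∃ t' ∈ Ico 0 t, ∃ z ∈ ball (0 : ℂ) 1, contactQuot κ q A W G t' z = 0
    · obtain ⟨t', ht', hz'⟩ := hcase
      obtain ⟨t₁, ht₁⟩ := (h.isCompact_zeros ht'.1 (ht'.2.trans_le ht.2)).exists_isLeast
        ⟨t', ⟨ht'.1, le_rfl⟩, hz'⟩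
      refine ⟨t₁, ⟨ht₁.1.1.1, ht₁.1.1.2.trans (ht'.2.le.trans ht.2)⟩, ht₁.1.2, ?_⟩
      intro s hs y hy hy0
      exact absurd (ht₁.2 ⟨⟨hs.1, hs.2.le.trans ht₁.1.1.2⟩, y, hy, hy0⟩) (not_le.2 hs.2)
    · push Not at hcase
      exact ⟨t, ht, ⟨z, hz, hE⟩, hcase⟩
  have ht0 : 0 < t₁ := by
    rcases ht₁.1.eq_or_lt with h0 | h0
    · rw [← h0] at hEx
      exact absurd hEx (h.contactQuot_zero_ne x)
    · exact h0
  have hall : ball (0 : ℂ) 1 ⊆ {z | contactQuot κ q A W G t₁ z = 0} := by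
    have hcont : ContinuousOn (contactQuot κ q A W G t₁) (ball 0 1) :=
      h.continuousOn_contactQuot.comp (f := fun z => (t₁, z)) (by fun_prop) fun y hy => ⟨ht₁, hy⟩
    have hopen1 : IsOpen (ball (0 : ℂ) 1 ∩ {z | contactQuot κ q A W G t₁ z = 0}) := by
      rw [isOpen_iff_mem_nhds]
      rintro y ⟨hy, hy0⟩
      exact inter_mem (isOpen_ball.mem_nhds hy)
        (h.eventually_eq_zero ht0 ht₁.2 hfree hy hy0)
    have hopen2 : IsOpen (ball (0 : ℂ) 1 ∩ {z | contactQuot κ q A W G t₁ z ≠ 0}) :=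
      hcont.isOpen_inter_preimage isOpen_ball isOpen_ne
    intro y hy
    by_contra hy0
    obtain ⟨p, -, hp1, hp2⟩ := (convex_ball (0 : ℂ) 1).isPreconnected _ _ hopen1 hopen2
      (fun p hp => (em (contactQuot κ q A W G t₁ p = 0)).imp (fun h => ⟨hp, h⟩) (fun h => ⟨hp, h⟩))
      ⟨x, hx, hx, hEx⟩ ⟨y, hy, hy, hy0⟩
    exact hp2.2 hp1.2
  have hwt := smul_mem_ball ht₁ hw₁
  have hqlim : Tendsto (fun x : ℝ => q (t₁ * W x) * (1 + κ * x)) (𝓝[<] 1)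
      (𝓝 (q (t₁ * w₁) * (1 + κ * (1 : ℝ)))) := by
    refine Tendsto.mul ?_ ?_
    · exact ((h.hasFDerivAt_q _ hwt).continuousAt.tendsto).comp (hlim.const_mul _)
    · exact ((by fun_prop : Continuous fun x : ℝ => (1 + κ * x : ℂ)).tendsto 1).mono_left
        nhdsWithin_le_nhds
  have hmlim : Tendsto (fun x : ℝ => (κ + x : ℂ)) (𝓝[<] 1) (𝓝 (κ + (1 : ℝ))) :=
    ((by fun_prop : Continuous fun x : ℝ => (κ + x : ℂ)).tendsto 1).mono_left nhdsWithin_le_nhds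
  have hev : (fun x : ℝ => q (t₁ * W x) * (1 + κ * x)) =ᶠ[𝓝[<] 1] fun x : ℝ => (κ + x : ℂ) := by
    filter_upwards [Ioo_mem_nhdsLT (zero_lt_one' ℝ)] with x hx
    have hxD : (x : ℂ) ∈ ball (0 : ℂ) 1 := by
      rw [mem_ball_zero_iff, norm_real, Real.norm_of_nonneg hx.1.le]; exact hx.2
    have hx0 : (x : ℂ) ≠ 0 := by exact_mod_cast hx.1.ne'
    have h0 : contactQuot κ q A W G t₁ x = 0 := hall hxD
    simp only [contactQuot, hx0, if_false, div_eq_zero_iff, or_false, sub_eq_zero] at h0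
    exact h0.symm
  have heq := tendsto_nhds_unique (hqlim.congr' hev) hmlim
  have hk : (1 + κ : ℂ) ≠ 0 := by
    have : (1 + κ : ℝ) ≠ 0 := by linarith [h.nonneg]
    exact_mod_cast this
  have hq1 : q (t₁ * w₁) = 1 := by
    refine mul_right_cancel₀ hk ?_
    simp only [ofReal_one, mul_one] at heq
    rw [heq, one_mul, add_comm]
  have := h.norm_q_lt _ hwt
  rw [hq1, norm_one] at this
  exact lt_irrefl _ this

end ContactPair

open Complex in
/-- The argument of `1 - z e^{-iθ}`. -/
noncomputable def argOneSub (θ : ℝ) (z : ℂ) : ℝ := arg (1 - z * exp (-(θ * I)))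

open Complex Metric in
theorem one_sub_mul_exp_re_pos (θ : ℝ) {z : ℂ} (hz : z ∈ ball (0 : ℂ) 1) :
    0 < (1 - z * exp (-(θ * I))).re := by
  have h1 : ‖z * exp (-(θ * I))‖ < 1 := by
    rw [norm_mul, ← neg_mul, ← ofReal_neg, norm_exp_ofReal_mul_I, mul_one]; simpa using hz
  have := (abs_le.1 (abs_re_le_norm (z * exp (-(θ * I))))).2
  rw [sub_re, one_re]; linarith

open Complex ComplexConjugate Metric in
theorem hasFDerivAt_argOneSub (θ : ℝ) {z : ℂ} (hz : z ∈ ball (0 : ℂ) 1) :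
    HasFDerivAt (fun z => (argOneSub θ z : ℂ))
      (wirt (I / 2 * (exp (-(θ * I)) / (1 - z * exp (-(θ * I)))))
        (conj (I / 2 * (exp (-(θ * I)) / (1 - z * exp (-(θ * I))))))) z := by
  set e := exp (-(θ * I)) with he
  have hre := one_sub_mul_exp_re_pos θ hz
  rw [← he] at hre
  have hlog : HasDerivAt (fun z : ℂ => log (1 - z * e)) (-e / (1 - z * e)) z := by
    have h1 : HasDerivAt (fun z : ℂ => 1 - z * e) (-e) z := by
      simpa using ((hasDerivAt_id z).mul_const e).const_sub 1
    exact h1.clog (Or.inl hre)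
  have h3 := (hlog.const_mul (((-1 / 2 : ℝ) : ℂ) * I)).hasFDerivAt_wirt
  have h4 := (conjCLE : ℂ →L[ℝ] ℂ).hasFDerivAt.comp z h3
  have hval : ((-1 / 2 : ℝ) : ℂ) * I * (-e / (1 - z * e)) = I / 2 * (e / (1 - z * e)) := by
    push_cast; ring
  refine ((h3.add h4).congr_fderiv ?_).congr_of_eventuallyEq
    (Filter.Eventually.of_forall fun z => ?_)
  · rw [hval]
    ext x; simp [wirt_apply]
  · apply Complex.ext <;>
    simp only [Function.comp, ContinuousLinearEquiv.coe_coe, conjCLE_apply, Pi.add_apply, add_re,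
      add_im, conj_re, conj_im, mul_re, mul_im, ofReal_re, ofReal_im, I_re, I_im, log_im,
      argOneSub, ← he] <;> ring

open Complex ComplexConjugate in
theorem im_one_sub_mul_conj (s : ℂ) (δ : ℝ) :
    ((1 - s * exp (-(δ * I))) * conj (1 - s * exp (δ * I)) * exp (δ * I)).im =
      Real.sin δ * (1 - ‖s‖ ^ 2) := by
  have h1 : exp (δ * I) = Real.cos δ + Real.sin δ * I := by
    rw [exp_mul_I]; simp
  have h2 : exp (-(δ * I)) = Real.cos δ - Real.sin δ * I := by
    rw [← neg_mul, exp_mul_I]; simp; ring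
  rw [h1, h2, Complex.sq_norm, normSq_apply]
  simp only [mul_im, mul_re, sub_re, sub_im, add_re, add_im, one_re, one_im, conj_re, conj_im,
    ofReal_re, ofReal_im, I_re, I_im]
  have := Real.sin_sq_add_cos_sq δ
  linear_combination (-Real.sin δ * (s.re * s.re + s.im * s.im)) * this

open Complex ComplexConjugate in
theorem arg_sub_arg_add_pos {s : ℂ} (hs : ‖s‖ < 1) {δ : ℝ} (h0 : 0 < δ) (h1 : δ < π)
    (hu : 0 < (1 - s * exp (-(δ * I))).re) (hv : 0 < (1 - s * exp (δ * I)).re) :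
    0 < arg (1 - s * exp (-(δ * I))) - arg (1 - s * exp (δ * I)) + δ := by
  have him := im_one_sub_mul_conj s δ
  set u := 1 - s * exp (-(δ * I)) with hudef
  set v := 1 - s * exp (δ * I) with hvdef
  have hpu : ‖u‖ * exp (arg u * I) = u := norm_mul_exp_arg_mul_I u
  have hpv : conj v = ‖v‖ * exp (-(arg v * I)) := by
    conv_lhs => rw [← norm_mul_exp_arg_mul_I v]
    rw [map_mul, conj_ofReal, ← exp_conj, map_mul, conj_ofReal, conj_I, mul_neg]
  have e : u * conj v * exp (δ * I) =
      ((‖u‖ * ‖v‖ : ℝ) : ℂ) * exp (((arg u - arg v + δ : ℝ) : ℂ) * I) := by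
    rw [hpv]
    nth_rewrite 1 [← hpu]
    rw [show (((arg u - arg v + δ : ℝ) : ℂ) * I) = arg u * I + -(arg v * I) + δ * I by push_cast; ring,
      Complex.exp_add, Complex.exp_add]
    push_cast; ring
  rw [e, im_ofReal_mul, exp_ofReal_mul_I_im] at him
  have hpos : 0 < Real.sin δ * (1 - ‖s‖ ^ 2) :=
    mul_pos (Real.sin_pos_of_pos_of_lt_pi h0 h1) (by nlinarith [norm_nonneg s])
  by_contra hle
  push Not at hle
  have hau := abs_lt.1 (abs_arg_lt_pi_div_two_iff.2 (Or.inl hu))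
  have hav := abs_lt.1 (abs_arg_lt_pi_div_two_iff.2 (Or.inl hv))
  have hsin := Real.sin_nonpos_of_nonpos_of_neg_pi_le hle (by linarith)
  nlinarith [mul_nonneg (norm_nonneg u) (norm_nonneg v)]

open Complex Metric in
/-- Positivity of harmonic measure of a boundary arc. -/
theorem argOneSub_sub_add_pos {z : ℂ} (hz : z ∈ ball (0 : ℂ) 1) {x y : ℝ} (hxy : x < y)
    (hyx : y - x < 2 * π) : 0 < argOneSub y z - argOneSub x z + (y - x) / 2 := by
  set s := z * exp (-(((x + y) / 2 : ℝ) * I)) with hs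
  have hsn : ‖s‖ < 1 := by
    rw [hs, norm_mul, ← neg_mul, ← ofReal_neg, norm_exp_ofReal_mul_I, mul_one]; simpa using hz
  have ey : s * exp (-(((y - x) / 2 : ℝ) * I)) = z * exp (-(y * I)) := by
    rw [hs, mul_assoc, ← Complex.exp_add]; congr 2; push_cast; ring
  have ex : s * exp (((y - x) / 2 : ℝ) * I) = z * exp (-(x * I)) := by
    rw [hs, mul_assoc, ← Complex.exp_add]; congr 2; push_cast; ring
  have := arg_sub_arg_add_pos hsn (δ := (y - x) / 2) (by linarith) (by linarith)
    (by rw [ey]; exact one_sub_mul_exp_re_pos y hz) (by rw [ex]; exact one_sub_mul_exp_re_pos x hz)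
  rw [ex, ey] at this
  exact this

open Complex in
/-- The harmonic map onto a trapezoid parametrizing a Scherk type minimal graph. -/
noncomputable def scherkMap (X₁ X₂ Y μ : ℝ) (z : ℂ) : ℂ :=
  X₁ * argOneSub 0 z - X₂ * argOneSub π z
    + (-((X₁ - X₂) / 2) + Y * I) * argOneSub μ z + (-((X₁ - X₂) / 2) - Y * I) * argOneSub (-μ) z

open Complex in
theorem scherkMap_zero (X₁ X₂ Y μ : ℝ) : scherkMap X₁ X₂ Y μ 0 = 0 := by
  simp [scherkMap, argOneSub]

open Complex Metric in
theorem norm_scherkMap_lt_one {X₁ X₂ Y μ : ℝ} (hX₁ : 0 < X₁) (hX₂ : 0 < X₂)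
    (hμ0 : 0 < μ) (hμπ : μ < π) (hN₁ : (π * X₁ / 2) ^ 2 + (Y * (π - μ)) ^ 2 ≤ 1)
    (hN₂ : (π * X₂ / 2) ^ 2 + (Y * μ) ^ 2 ≤ 1) {z : ℂ} (hz : z ∈ ball (0 : ℂ) 1) :
    ‖scherkMap X₁ X₂ Y μ z‖ < 1 := by
  have o1 := argOneSub_sub_add_pos hz (x := 0) (y := μ) hμ0 (by linarith)
  have o2 := argOneSub_sub_add_pos hz (x := μ) (y := π) hμπ (by linarith)
  have o3 := argOneSub_sub_add_pos hz (x := -π) (y := -μ) (by linarith) (by linarith)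
  have o4 := argOneSub_sub_add_pos hz (x := -μ) (y := 0) (by linarith) (by linarith)
  have hπ : argOneSub (-π) z = argOneSub π z := by
    simp only [argOneSub]
    congr 3
    rw [ofReal_neg, neg_mul, neg_neg, Complex.exp_neg, exp_pi_mul_I]; norm_num
  rw [hπ] at o3
  have hre : (scherkMap X₁ X₂ Y μ z).re = X₁ * argOneSub 0 z - X₂ * argOneSub π z
      - (X₁ - X₂) / 2 * (argOneSub μ z + argOneSub (-μ) z) := by
    simp [scherkMap]; ring
  have him : (scherkMap X₁ X₂ Y μ z).im = Y * (argOneSub μ z - argOneSub (-μ) z) := by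
    simp [scherkMap]; ring
  have hn : ‖scherkMap X₁ X₂ Y μ z‖ ^ 2 < 1 := by
    rw [Complex.sq_norm, normSq_apply, hre, him]
    set a0 := argOneSub 0 z
    set aπ := argOneSub π z
    set am := argOneSub μ z
    set an := argOneSub (-μ) z
    obtain ⟨p, hp⟩ : ∃ p, am - an + μ = π * p := ⟨(am - an + μ) / π, by field_simp⟩
    have hpi := Real.pi_pos
    have hp0 : 0 < p := pos_of_mul_pos_right (by linarith) hpi.le
    have hp1 : 0 < 1 - p := pos_of_mul_pos_right (a := π) (by linarith) hpi.le
    have hR : (X₁ * a0 - X₂ * aπ - (X₁ - X₂) / 2 * (am + an)) ^ 2 <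
        (p * (π * X₁ / 2) + (1 - p) * (π * X₂ / 2)) ^ 2 := by
      have e1 : p * (π * X₁ / 2) + (1 - p) * (π * X₂ / 2) =
          X₁ * (am - an + μ) / 2 + X₂ * (π - (am - an + μ)) / 2 := by rw [hp]; ring
      rw [e1]
      refine sq_lt_sq' ?_ ?_
      · nlinarith [mul_pos hX₁ o4, mul_pos hX₂ o2]
      · nlinarith [mul_pos hX₁ o1, mul_pos hX₂ o3]
    have hI : Y * (am - an) = p * (Y * (π - μ)) + (1 - p) * (-(Y * μ)) := by
      have : am - an = π * p - μ := by linarith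
      rw [this]; ring
    have conv : ∀ a b : ℝ, (p * a + (1 - p) * b) ^ 2 ≤ p * a ^ 2 + (1 - p) * b ^ 2 := by
      intro a b
      nlinarith [mul_nonneg (mul_nonneg hp0.le hp1.le) (sq_nonneg (a - b))]
    have c1 := conv (π * X₁ / 2) (π * X₂ / 2)
    have c2 := conv (Y * (π - μ)) (-(Y * μ))
    have c3 := mul_le_mul_of_nonneg_left hN₁ hp0.le
    have c4 := mul_le_mul_of_nonneg_left hN₂ hp1.le
    rw [hI]
    nlinarith
  nlinarith [norm_nonneg (scherkMap X₁ X₂ Y μ z)]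

open Complex Metric Filter Topology in
theorem tendsto_scherkMap {X₁ X₂ Y μ : ℝ} (hμ0 : 0 < μ) (hμπ : μ < π) :
    Tendsto (fun x : ℝ => scherkMap X₁ X₂ Y μ x) (𝓝[<] 1) (𝓝 ((Y * (π - μ) : ℝ) * I)) := by
  have hs : 0 < Real.sin (μ / 2) := Real.sin_pos_of_pos_of_lt_pi (by linarith) (by linarith)
  have hs2 : Real.sin μ = 2 * Real.sin (μ / 2) * Real.cos (μ / 2) := by
    rw [← Real.sin_two_mul]; congr 1; ring
  have hc2 : Real.cos μ = 1 - 2 * Real.sin (μ / 2) ^ 2 := by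
    have := Real.cos_two_mul' (μ / 2)
    rw [show 2 * (μ / 2) = μ by ring] at this
    have h2 := Real.sin_sq_add_cos_sq (μ / 2)
    linarith
  have key : ∀ ν : ℝ, (ν = μ ∨ ν = -μ) → 0 < (1 - exp (-(ν * I))).re := by
    intro ν hν
    have h1 : (1 - exp (-(ν * I))).re = 1 - Real.cos ν := by
      rw [← neg_mul, ← ofReal_neg, sub_re, exp_ofReal_mul_I_re, Real.cos_neg, one_re]
    have h2 : Real.cos ν = Real.cos μ := by
      rcases hν with rfl | rfl <;> simp
    rw [h1, h2, hc2]; nlinarith [pow_pos hs 2]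
  have hargμ : arg (1 - exp (-(μ * I))) = (π - μ) / 2 := by
    have e : 1 - exp (-(μ * I)) =
        ((2 * Real.sin (μ / 2) : ℝ) : ℂ) * (Complex.cos ((π - μ) / 2 : ℝ) + Complex.sin ((π - μ) / 2 : ℝ) * I) := by
      rw [← ofReal_cos, ← ofReal_sin, show (π - μ) / 2 = π / 2 - μ / 2 by ring,
        Real.cos_pi_div_two_sub, Real.sin_pi_div_two_sub, ← neg_mul, ← ofReal_neg, exp_mul_I,
        ← ofReal_cos, ← ofReal_sin, Real.cos_neg, Real.sin_neg, hs2, hc2]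
      push_cast; ring
    rw [e, arg_mul_cos_add_sin_mul_I (by positivity) ⟨by linarith, by linarith⟩]
  have hargn : arg (1 - exp (-((-μ : ℝ) * I))) = -((π - μ) / 2) := by
    have e : 1 - exp (-((-μ : ℝ) * I)) = (starRingEnd ℂ) (1 - exp (-(μ * I))) := by
      rw [map_sub, ← exp_conj]; simp
    rw [e, arg_conj, if_neg, hargμ]
    rw [hargμ]; linarith
  have lim : ∀ ν : ℝ, (ν = μ ∨ ν = -μ) → Tendsto (fun x : ℝ => (argOneSub ν x : ℂ)) (𝓝[<] 1)
      (𝓝 (arg (1 - exp (-(ν * I))) : ℝ)) := by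
    intro ν hν
    have h1 : ContinuousAt (fun x : ℝ => arg (1 - x * exp (-(ν * I)))) 1 := by
      refine ContinuousAt.comp (g := arg) (continuousAt_arg ?_) (by fun_prop)
      rw [ofReal_one, one_mul]
      exact Or.inl (key ν hν)
    have h2 := (continuous_ofReal.continuousAt.comp h1).tendsto.mono_left
      (nhdsWithin_le_nhds (s := Iio 1))
    simpa [argOneSub, Function.comp_def] using h2
  have hz : (fun x : ℝ => scherkMap X₁ X₂ Y μ x) =ᶠ[𝓝[<] 1] fun x : ℝ =>
      (-((X₁ - X₂) / 2) + Y * I) * argOneSub μ x + (-((X₁ - X₂) / 2) - Y * I) * argOneSub (-μ) x := by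
    filter_upwards [Ioo_mem_nhdsLT (zero_lt_one' ℝ)] with x hx
    have h0 : argOneSub 0 x = 0 := by
      have : (1 : ℂ) - x * exp (-((0 : ℝ) * I)) = ((1 - x : ℝ) : ℂ) := by simp
      rw [argOneSub, this, arg_ofReal_of_nonneg (by linarith [hx.2])]
    have hp : argOneSub π x = 0 := by
      have : (1 : ℂ) - x * exp (-(π * I)) = ((1 + x : ℝ) : ℂ) := by
        rw [Complex.exp_neg, exp_pi_mul_I]; push_cast; norm_num
      rw [argOneSub, this, arg_ofReal_of_nonneg (by linarith [hx.1])]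
    simp [scherkMap, h0, hp]
  refine Tendsto.congr' hz.symm ?_
  have := ((lim μ (Or.inl rfl)).const_mul (-((X₁ - X₂) / 2) + Y * I : ℂ)).add
    ((lim (-μ) (Or.inr rfl)).const_mul (-((X₁ - X₂) / 2) - Y * I : ℂ))
  rw [hargμ, hargn] at this
  convert this using 2
  push_cast; ring

theorem conj_pair_div_add_div {c d b s z : ℂ} (h : s ^ 2 + b ^ 2 = 1)
    (h3 : 1 - z * (-b - s * Complex.I) ≠ 0) (h4 : 1 - z * (-b + s * Complex.I) ≠ 0) :
    (-c + d * Complex.I) * ((-b - s * Complex.I) / (1 - z * (-b - s * Complex.I))) +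
      (-c - d * Complex.I) * ((-b + s * Complex.I) / (1 - z * (-b + s * Complex.I))) =
      (2 * c * (b + z) + 2 * d * s) / (1 + 2 * b * z + z ^ 2) := by
  have hQ : (1 - z * (-b - s * Complex.I)) * (1 - z * (-b + s * Complex.I)) =
      1 + 2 * b * z + z ^ 2 := by
    linear_combination z ^ 2 * h - z ^ 2 * s ^ 2 * Complex.I_sq
  rw [mul_div_assoc', mul_div_assoc', div_add_div _ _ h3 h4, hQ]
  congr 1
  linear_combination (2 * c * z) * h + (-2 * c * z * s ^ 2 - 2 * d * s) * Complex.I_sq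

theorem scherk_partial_fractions {α k l b z : ℂ} (hb1 : 1 + b ≠ 0) (hb2 : 1 - b ≠ 0)
    (hz1 : 1 - z ≠ 0) (hz2 : 1 + z ≠ 0) (hQ : 1 + 2 * b * z + z ^ 2 ≠ 0) :
    α / 2 * (k + l) ^ 2 / (1 + b) * (1 / (1 - z)) - α / 2 * (k - l) ^ 2 / (1 - b) * (-1 / (1 + z)) +
      (2 * ((α / 2 * (k + l) ^ 2 / (1 + b) - α / 2 * (k - l) ^ 2 / (1 - b)) / 2) * (b + z)
        + α * (k ^ 2 - l ^ 2)) / (1 + 2 * b * z + z ^ 2) =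
      2 * α * (k + l * z) ^ 2 / ((1 - z ^ 2) * (1 + 2 * b * z + z ^ 2)) := by
  have : 1 - z ^ 2 ≠ 0 := by
    rw [show 1 - z ^ 2 = (1 - z) * (1 + z) by ring]; exact mul_ne_zero hz1 hz2
  field_simp
  ring

open Complex ComplexConjugate Metric in
theorem hasFDerivAt_scherkMap {α κ b X₁ X₂ Y μ : ℝ} (hb : |b| < 1) (hκ : |κ| < 1)
    (hcos : Real.cos μ = -b) (hX₁ : X₁ = α / 2 * (1 + κ) ^ 2 / (1 + b))
    (hX₂ : X₂ = α / 2 * (1 - κ) ^ 2 / (1 - b))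
    (hY : Y * Real.sin μ = α / 2 * (1 - κ ^ 2)) {z : ℂ} (hz : z ∈ ball (0 : ℂ) 1) :
    HasFDerivAt (scherkMap X₁ X₂ Y μ)
      (wirt (I * α * (1 + κ * z) ^ 2 / ((1 - z ^ 2) * (1 + 2 * b * z + z ^ 2)))
        (conj (((κ + z) / (1 + κ * z)) ^ 2 *
          (I * α * (1 + κ * z) ^ 2 / ((1 - z ^ 2) * (1 + 2 * b * z + z ^ 2)))))) z := by
  have hb' := abs_lt.1 hb
  have ne : ∀ θ : ℝ, 1 - z * exp (-(θ * I)) ≠ 0 := fun θ h0 => by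
    have := one_sub_mul_exp_re_pos θ hz
    rw [h0] at this
    exact lt_irrefl _ this
  have e1 : exp (-((0 : ℝ) * I)) = 1 := by simp
  have e2 : exp (-(π * I)) = -1 := by rw [Complex.exp_neg, exp_pi_mul_I]; norm_num
  have hsc := Real.sin_sq_add_cos_sq μ
  rw [hcos] at hsc
  have e3 : exp (-(μ * I)) = -b - Real.sin μ * I := by
    rw [← neg_mul, ← ofReal_neg, exp_mul_I, ← ofReal_cos, ← ofReal_sin, Real.cos_neg, Real.sin_neg,
      hcos]
    push_cast; ring
  have e4 : exp (-((-μ : ℝ) * I)) = -b + Real.sin μ * I := by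
    rw [← neg_mul, ← ofReal_neg, neg_neg, exp_mul_I, ← ofReal_cos, ← ofReal_sin, hcos]
    push_cast; ring
  have n1 := ne 0
  have n2 := ne π
  have n3 := ne μ
  have n4 := ne (-μ)
  rw [e1, mul_one] at n1
  rw [e2, mul_neg_one, sub_neg_eq_add] at n2
  rw [e3] at n3
  rw [e4] at n4
  have hscC : (Real.sin μ : ℂ) ^ 2 + (b : ℂ) ^ 2 = 1 := by
    have : Real.sin μ ^ 2 + b ^ 2 = 1 := by linarith
    exact_mod_cast this
  have hb1 : (1 + b : ℂ) ≠ 0 := by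
    have : (1 + b : ℝ) ≠ 0 := by linarith
    exact_mod_cast this
  have hb2 : (1 - b : ℂ) ≠ 0 := by
    have : (1 - b : ℝ) ≠ 0 := by linarith
    exact_mod_cast this
  have hQ : 1 + 2 * b * z + z ^ 2 ≠ 0 := by
    have : (1 - z * (-b - Real.sin μ * I)) * (1 - z * (-b + Real.sin μ * I)) =
        1 + 2 * b * z + z ^ 2 := by
      linear_combination z ^ 2 * hscC - z ^ 2 * (Real.sin μ : ℂ) ^ 2 * I_sq
    rw [← this]
    exact mul_ne_zero n3 n4
  have hX₁C : (X₁ : ℂ) = α / 2 * (1 + κ) ^ 2 / (1 + b) := by rw [hX₁]; push_cast; ring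
  have hX₂C : (X₂ : ℂ) = α / 2 * (1 - κ) ^ 2 / (1 - b) := by rw [hX₂]; push_cast; ring
  have hYC : 2 * (Y : ℂ) * Real.sin μ = α * (1 - κ ^ 2) := by
    have : 2 * Y * Real.sin μ = α * (1 - κ ^ 2) := by linarith
    exact_mod_cast this
  have hκz : (1 + κ * z : ℂ) ≠ 0 := by
    intro h0
    have h1 : ‖(κ * z : ℂ)‖ = 1 := by
      rw [← norm_neg, show -(κ * z : ℂ) = 1 by linear_combination -h0, norm_one]
    rw [norm_mul, norm_real, Real.norm_eq_abs] at h1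
    rw [mem_ball_zero_iff] at hz
    nlinarith [abs_nonneg κ, norm_nonneg z]
  have hd := ((((hasFDerivAt_argOneSub 0 hz).const_mul (X₁ : ℂ)).sub
    ((hasFDerivAt_argOneSub π hz).const_mul (X₂ : ℂ))).add
    ((hasFDerivAt_argOneSub μ hz).const_mul (-((X₁ - X₂) / 2) + Y * I : ℂ))).add
    ((hasFDerivAt_argOneSub (-μ) hz).const_mul (-((X₁ - X₂) / 2) - Y * I : ℂ))
  refine hd.congr_fderiv ?_
  rw [e1, e2, e3, e4]
  have P1 := conj_pair_div_add_div (c := ((X₁ : ℂ) - X₂) / 2) (d := Y) hscC n3 n4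
  have P2 := conj_pair_div_add_div (c := ((X₁ : ℂ) - X₂) / 2) (d := -Y) hscC n3 n4
  have F1 := scherk_partial_fractions (α := α) (k := 1) (l := κ) hb1 hb2 n1 n2 hQ
  have F2 := scherk_partial_fractions (α := α) (k := κ) (l := 1) hb1 hb2 n1 n2 hQ
  rw [one_pow, ← hX₁C, ← hX₂C, ← hYC, ← P1] at F1
  rw [one_pow, show (κ + 1 : ℂ) ^ 2 = (1 + κ) ^ 2 by ring, show (κ - 1 : ℂ) ^ 2 = (1 - κ) ^ 2 by ring,
    ← hX₁C, ← hX₂C, show (α : ℂ) * (κ ^ 2 - 1) = 2 * (-Y) * Real.sin μ by linear_combination hYC,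
    ← P2, one_mul] at F2
  have hm : ((κ + z) / (1 + κ * z)) ^ 2 *
      (I * α * (1 + κ * z) ^ 2 / ((1 - z ^ 2) * (1 + 2 * b * z + z ^ 2))) =
      I * α * (κ + z) ^ 2 / ((1 - z ^ 2) * (1 + 2 * b * z + z ^ 2)) := by
    rw [div_pow]; field_simp
  rw [hm]
  rw [smul_wirt, smul_wirt, smul_wirt, smul_wirt, sub_eq_add_neg, ← neg_one_smul ℂ (wirt _ _),
    smul_wirt, wirt_add, wirt_add, wirt_add]
  congr 1
  · linear_combination (I / 2) * F1
  · have : I * α * (κ + z) ^ 2 / ((1 - z ^ 2) * (1 + 2 * b * z + z ^ 2)) =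
        X₁ * (I / 2 * (1 / (1 - z * 1))) - X₂ * (I / 2 * (-1 / (1 - z * -1)))
        + (-((X₁ - X₂) / 2) - Y * I) * (I / 2 * ((-b - Real.sin μ * I) /
          (1 - z * (-b - Real.sin μ * I))))
        + (-((X₁ - X₂) / 2) + Y * I) * (I / 2 * ((-b + Real.sin μ * I) /
          (1 - z * (-b + Real.sin μ * I)))) := by
      linear_combination -(I / 2) * F2
    rw [this, map_add, map_add, map_sub, map_mul conj (X₁ : ℂ), map_mul conj (X₂ : ℂ),
      map_mul conj (-((X₁ - X₂) / 2) - Y * I : ℂ), map_mul conj (-((X₁ - X₂) / 2) + Y * I : ℂ)]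
    have hr : ((X₁ : ℂ) - X₂) / 2 = (((X₁ - X₂) / 2 : ℝ) : ℂ) := by push_cast; ring
    rw [hr]
    simp only [map_add, map_sub, map_neg, map_mul, conj_ofReal, conj_I]
    ring

theorem scherk_poly_first_nonneg {k x : ℝ} (hk : 0 ≤ k) (hx : 0 ≤ x) (hx1 : x ≤ 1) :
    (1 - k ^ 2) ^ 2 * (1 + k) ^ 2 * ((1 + k) ^ 2 * (1 + x / 2 * k) ^ 2 +
      (1 + (x - 1) * k) ^ 2 * (1 - k) * (1 + (1 + x) * k)) ≤
      2 * (1 + (1 + x) * k) ^ 2 * (1 + k ^ 2) ^ 4 := by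
  have p2 : x ^ 2 ≤ 1 := pow_le_one₀ hx hx1
  have p3 : x ^ 3 ≤ 1 := pow_le_one₀ hx hx1
  have q2 : 0 ≤ x ^ 2 := by positivity
  have q3 : 0 ≤ x ^ 3 := by positivity
  have c2 : 0 ≤ (11 - x - 5 / 4 * x ^ 2) * k ^ 2 := mul_nonneg (by linarith) (by positivity)
  have c3 : 0 ≤ (20 + 24 * x - 3 * x ^ 2 - x ^ 3) * k ^ 3 :=
    mul_nonneg (by linarith) (by positivity)
  have c4 : 0 ≤ (20 + 24 * x + 17 * x ^ 2 - x ^ 3) * k ^ 4 :=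
    mul_nonneg (by linarith) (by positivity)
  have c5 : 0 ≤ (28 + 16 * x + 7 * x ^ 2 + 3 * x ^ 3) * k ^ 5 := by positivity
  have c6 : 0 ≤ (26 + 22 * x + 5 / 2 * x ^ 2 + 3 * x ^ 3) * k ^ 6 := by positivity
  have c7 : 0 ≤ (12 + 24 * x - 5 * x ^ 2 - 3 * x ^ 3) * k ^ 7 :=
    mul_nonneg (by linarith) (by positivity)
  have c8 : 0 ≤ (4 + 16 * x + 13 * x ^ 2 - 3 * x ^ 3) * k ^ 8 :=
    mul_nonneg (by linarith) (by positivity)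
  have c9 : 0 ≤ (4 + x ^ 2 + x ^ 3) * k ^ 9 := by positivity
  have c10 : 0 ≤ (3 + 3 * x + 3 / 4 * x ^ 2 + x ^ 3) * k ^ 10 := by positivity
  linarith

theorem scherk_poly_second_nonneg {k x : ℝ} (hk : 0 ≤ k) (hx : 0 ≤ x) (hx1 : x ≤ 1) :
    (1 - k) * (1 + k) ^ 2 * (1 + x / 2 * k) ^ 2 * ((1 - k) ^ 3 * (1 + (1 + x) * k) ^ 3 +
      (1 + k) ^ 2 * ((1 - k) * (1 + (1 + x) * k) + (1 - x / 2) * k * (1 + x / 2 * k)) ^ 2) ≤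
      2 * (1 + (1 + x) * k) ^ 3 * (1 + k ^ 2) ^ 4 := by
  have p2 : x ^ 2 ≤ 1 := pow_le_one₀ hx hx1
  have p3 : x ^ 3 ≤ 1 := pow_le_one₀ hx hx1
  have p4 : x ^ 4 ≤ 1 := pow_le_one₀ hx hx1
  have p5 : x ^ 5 ≤ 1 := pow_le_one₀ hx hx1
  have p6 : x ^ 6 ≤ 1 := pow_le_one₀ hx hx1
  have q2 : 0 ≤ x ^ 2 := by positivity
  have q3 : 0 ≤ x ^ 3 := by positivity
  have q4 : 0 ≤ x ^ 4 := by positivity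
  have q5 : 0 ≤ x ^ 5 := by positivity
  have q6 : 0 ≤ x ^ 6 := by positivity
  have c2 : 0 ≤ (11 + 3 * x - 5 / 4 * x ^ 2) * k ^ 2 := mul_nonneg (by linarith) (by positivity)
  have c3 : 0 ≤ (33 + 39 * x + 25 / 4 * x ^ 2 - 5 / 2 * x ^ 3) * k ^ 3 :=
    mul_nonneg (by linarith) (by positivity)
  have c4 : 0 ≤ (44 + 62 * x + 47 * x ^ 2 + 13 / 2 * x ^ 3 - 3 / 2 * x ^ 4) * k ^ 4 :=
    mul_nonneg (by linarith) (by positivity)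
  have c5 : 0 ≤ (44 + 54 * x + 23 * x ^ 2 + 47 / 2 * x ^ 3 + 7 / 2 * x ^ 4 - 1 / 4 * x ^ 5) *
      k ^ 5 := mul_nonneg (by linarith) (by positivity)
  have c6 : 0 ≤ (41 + 67 * x + 43 / 4 * x ^ 2 - 13 * x ^ 3 + 57 / 16 * x ^ 4 + 7 / 16 * x ^ 5
      - 1 / 64 * x ^ 6) * k ^ 6 := mul_nonneg (by linarith) (by positivity)
  have c7 : 0 ≤ (35 + 65 * x + 153 / 4 * x ^ 2 - 4 * x ^ 3 - 117 / 16 * x ^ 4 + 1 / 16 * x ^ 5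
      - 3 / 64 * x ^ 6) * k ^ 7 := mul_nonneg (by linarith) (by positivity)
  have c8 : 0 ≤ (26 + 48 * x + 71 / 2 * x ^ 2 + 17 / 2 * x ^ 3 - 19 / 8 * x ^ 4 - 9 / 8 * x ^ 5
      - 1 / 32 * x ^ 6) * k ^ 8 := mul_nonneg (by linarith) (by positivity)
  have c9 : 0 ≤ (14 + 28 * x + 45 / 2 * x ^ 2 + 27 / 2 * x ^ 3 + 35 / 8 * x ^ 4 + 3 / 8 * x ^ 5
      + 1 / 32 * x ^ 6) * k ^ 9 := by positivity
  have c10 : 0 ≤ (6 + 12 * x + 4 * x ^ 2 - 2 * x ^ 3 + 5 / 16 * x ^ 4 + 11 / 16 * x ^ 5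
      + 3 / 64 * x ^ 6) * k ^ 10 := mul_nonneg (by linarith) (by positivity)
  have c11 : 0 ≤ (2 + 6 * x + 6 * x ^ 2 + 3 / 2 * x ^ 3 - 9 / 16 * x ^ 4 - 3 / 16 * x ^ 5
      + 1 / 64 * x ^ 6) * k ^ 11 := mul_nonneg (by linarith) (by positivity)
  linarith

/-- The parameters for which the Scherk-type map stays in the closed unit disk. -/
theorem exists_scherk_parameters {κ : ℝ} (hκ : 0 ≤ κ) (hκ1 : κ < 1) {α : ℝ}
    (hα : α = 2 * √2 / π * (1 - κ ^ 2) / (1 + κ ^ 2) ^ 2) :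
    ∃ b X₁ X₂ Y μ : ℝ, |b| < 1 ∧ 0 < μ ∧ μ < π ∧ Real.cos μ = -b ∧
      X₁ = α / 2 * (1 + κ) ^ 2 / (1 + b) ∧ X₂ = α / 2 * (1 - κ) ^ 2 / (1 - b) ∧
      Y * Real.sin μ = α / 2 * (1 - κ ^ 2) ∧ 0 < X₁ ∧ 0 < X₂ ∧
      (π * X₁ / 2) ^ 2 + (Y * (π - μ)) ^ 2 ≤ 1 ∧ (π * X₂ / 2) ^ 2 + (Y * μ) ^ 2 ≤ 1 := by
  have hπ := Real.pi_pos
  have hπ2 := Real.pi_gt_three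
  have hπ4 := Real.pi_le_four
  set x : ℝ := 2 * (π - 2) / (π + 2) with hx
  have hx0 : 0 ≤ x := by rw [hx]; apply div_nonneg <;> linarith
  have hx1 : x ≤ 1 := by rw [hx, div_le_one (by linarith)]; linarith
  have hxπ : 1 - x / 2 = 2 * (1 + x / 2) / π := by rw [hx]; field_simp; ring
  have hD : 0 < 1 + x / 2 * κ := by positivity
  have hE : 0 < 1 + (1 + x) * κ := by positivity
  have h1κ : 0 < 1 - κ := by linarith
  have h1κ' : 0 < 1 + κ := by linarith
  have h1κs : 0 < 1 - κ ^ 2 := by nlinarith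
  set b : ℝ := (1 + x / 2) * κ / (1 + x / 2 * κ) with hb
  have hb0 : 0 ≤ b := by positivity
  have eb1 : 1 - b = (1 - κ) / (1 + x / 2 * κ) := by rw [hb]; field_simp; ring
  have eb2 : 1 + b = (1 + (1 + x) * κ) / (1 + x / 2 * κ) := by rw [hb]; field_simp; ring
  have hb1 : 0 < 1 - b := by rw [eb1]; positivity
  have hbs : 0 < 1 - b ^ 2 := by nlinarith
  have ebs : 1 - b ^ 2 = (1 - κ) * (1 + (1 + x) * κ) / (1 + x / 2 * κ) ^ 2 := by
    rw [show 1 - b ^ 2 = (1 - b) * (1 + b) by ring, eb1, eb2]; field_simp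
  set β := Real.arcsin b with hβ
  have hsin : Real.sin β = b := Real.sin_arcsin (by linarith) (by linarith)
  have hcos : Real.cos β = √(1 - b ^ 2) := Real.cos_arcsin b
  have hβ0 : 0 ≤ β := Real.arcsin_nonneg.2 hb0
  have hβ2 : β < π / 2 := Real.arcsin_lt_pi_div_two.2 (by linarith)
  have hβb : b ≤ β := hsin ▸ Real.sin_le hβ0
  have hsq : √(1 - b ^ 2) ^ 2 = 1 - b ^ 2 := Real.sq_sqrt hbs.le
  have hsp : 0 < √(1 - b ^ 2) := Real.sqrt_pos.2 hbs
  have hβt : β ≤ b / (1 - b ^ 2) := by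
    have h1 := Real.le_tan hβ0 hβ2
    rw [Real.tan_eq_sin_div_cos, hsin, hcos] at h1
    refine h1.trans (div_le_div_of_nonneg_left hb0 hbs ?_)
    nlinarith [sq_nonneg b]
  have hα0 : 0 < α := by rw [hα]; positivity
  have hα2 : (π * α) ^ 2 = 8 * (1 - κ ^ 2) ^ 2 / (1 + κ ^ 2) ^ 4 := by
    have h2 : (√2 : ℝ) ^ 2 = 2 := Real.sq_sqrt (by norm_num)
    rw [hα]; field_simp; rw [h2]; ring
  have hU : (1 / 2 - β / π) ^ 2 ≤ ((1 + (x - 1) * κ) / (2 * (1 + x / 2 * κ))) ^ 2 := by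
    refine pow_le_pow_left₀ ?_ ?_ 2
    · rw [sub_nonneg, div_le_iff₀ hπ]; linarith
    · have e : (1 + (x - 1) * κ) / (2 * (1 + x / 2 * κ)) = 1 / 2 - b / π := by
        have : b / π = (1 - x / 2) * κ / (2 * (1 + x / 2 * κ)) := by rw [hxπ, hb]; field_simp
        rw [this]; field_simp; ring
      rw [e]; gcongr
  have hV : (1 / 2 + β / π) ^ 2 ≤ (((1 - κ) * (1 + (1 + x) * κ) +
      (1 - x / 2) * κ * (1 + x / 2 * κ)) / (2 * ((1 - κ) * (1 + (1 + x) * κ)))) ^ 2 := by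
    refine pow_le_pow_left₀ (by positivity) ?_ 2
    have e : ((1 - κ) * (1 + (1 + x) * κ) + (1 - x / 2) * κ * (1 + x / 2 * κ)) /
        (2 * ((1 - κ) * (1 + (1 + x) * κ))) = 1 / 2 + b / (1 - b ^ 2) / π := by
      rw [hxπ, ebs, hb]; field_simp
    rw [e]; gcongr
  refine ⟨b, _, _, α / 2 * (1 - κ ^ 2) / √(1 - b ^ 2), π / 2 + β, ?_, by linarith, by linarith, ?_,
    rfl, rfl, ?_, by positivity, by positivity, ?_, ?_⟩
  · rw [abs_lt]; constructor <;> linarith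
  · rw [add_comm, Real.cos_add_pi_div_two, hsin]
  · rw [add_comm, Real.sin_add_pi_div_two, hcos]; field_simp
  · have e : (π * (α / 2 * (1 + κ) ^ 2 / (1 + b)) / 2) ^ 2 +
        (α / 2 * (1 - κ ^ 2) / √(1 - b ^ 2) * (π - (π / 2 + β))) ^ 2 =
        (π * α) ^ 2 / 4 * ((1 + κ) ^ 4 / (4 * (1 + b) ^ 2) +
          (1 - κ ^ 2) ^ 2 / (1 - b ^ 2) * (1 / 2 - β / π) ^ 2) := by
      rw [mul_pow (_ / √(1 - b ^ 2)), div_pow _ (√(1 - b ^ 2)), hsq]; field_simp; ring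
    rw [e]
    refine (mul_le_mul_of_nonneg_left (add_le_add_right
      (mul_le_mul_of_nonneg_left hU (by positivity)) _) (by positivity)).trans ?_
    have R := scherk_poly_first_nonneg hκ hx0 hx1
    rw [hα2, ebs, eb2]
    have e' : 8 * (1 - κ ^ 2) ^ 2 / (1 + κ ^ 2) ^ 4 / 4 *
        ((1 + κ) ^ 4 / (4 * ((1 + (1 + x) * κ) / (1 + x / 2 * κ)) ^ 2) +
        (1 - κ ^ 2) ^ 2 / ((1 - κ) * (1 + (1 + x) * κ) / (1 + x / 2 * κ) ^ 2) *
        ((1 + (x - 1) * κ) / (2 * (1 + x / 2 * κ))) ^ 2) =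
        (1 - κ ^ 2) ^ 2 * (1 + κ) ^ 2 * ((1 + κ) ^ 2 * (1 + x / 2 * κ) ^ 2 +
        (1 + (x - 1) * κ) ^ 2 * (1 - κ) * (1 + (1 + x) * κ)) /
        (2 * (1 + (1 + x) * κ) ^ 2 * (1 + κ ^ 2) ^ 4) := by
      field_simp; ring
    rw [e', div_le_one (by positivity)]
    exact R
  · have e : (π * (α / 2 * (1 - κ) ^ 2 / (1 - b)) / 2) ^ 2 +
        (α / 2 * (1 - κ ^ 2) / √(1 - b ^ 2) * (π / 2 + β)) ^ 2 =
        (π * α) ^ 2 / 4 * ((1 - κ) ^ 4 / (4 * (1 - b) ^ 2) +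
          (1 - κ ^ 2) ^ 2 / (1 - b ^ 2) * (1 / 2 + β / π) ^ 2) := by
      rw [mul_pow (_ / √(1 - b ^ 2)), div_pow _ (√(1 - b ^ 2)), hsq]; field_simp; ring
    rw [e]
    refine (mul_le_mul_of_nonneg_left (add_le_add_right
      (mul_le_mul_of_nonneg_left hV (by positivity)) _) (by positivity)).trans ?_
    have R := scherk_poly_second_nonneg hκ hx0 hx1
    rw [hα2, ebs, eb1]
    have e' : 8 * (1 - κ ^ 2) ^ 2 / (1 + κ ^ 2) ^ 4 / 4 *
        ((1 - κ) ^ 4 / (4 * ((1 - κ) / (1 + x / 2 * κ)) ^ 2) +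
        (1 - κ ^ 2) ^ 2 / ((1 - κ) * (1 + (1 + x) * κ) / (1 + x / 2 * κ) ^ 2) *
        (((1 - κ) * (1 + (1 + x) * κ) + (1 - x / 2) * κ * (1 + x / 2 * κ)) /
          (2 * ((1 - κ) * (1 + (1 + x) * κ)))) ^ 2) =
        (1 - κ) * (1 + κ) ^ 2 * (1 + x / 2 * κ) ^ 2 * ((1 - κ) ^ 3 * (1 + (1 + x) * κ) ^ 3 +
        (1 + κ) ^ 2 * ((1 - κ) * (1 + (1 + x) * κ) + (1 - x / 2) * κ * (1 + x / 2 * κ)) ^ 2) /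
        (2 * (1 + (1 + x) * κ) ^ 3 * (1 + κ ^ 2) ^ 4) := by
      field_simp; ring
    rw [e', div_le_one (by positivity)]
    exact R

open Complex in
theorem eq_wirt (L : ℂ →L[ℝ] ℂ) : L = wirt ((L 1 - I * L I) / 2) ((L 1 + I * L I) / 2) := by
  ext x
  have hx : x = x.re • (1 : ℂ) + x.im • I := by
    simp [re_add_im]
  have h1 : L x = x.re * L 1 + x.im * L I := by
    conv_lhs => rw [hx]
    rw [map_add, map_smul, map_smul, real_smul, real_smul]
  rw [wirt_apply, h1, ← Complex.re_add_im ((starRingEnd ℂ) x), conj_re, conj_im]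
  conv_rhs => rw [← Complex.re_add_im x]
  push_cast
  simp only [add_re, ofReal_re, mul_re, I_re, ofReal_im, I_im, add_im, mul_im]
  push_cast
  linear_combination (x.im * L I) * I_sq

open Complex Metric in
/-- `(P, Q)` is the gradient of a solution of the minimal surface equation on the unit disk. -/
structure IsMinimalGradient (P Q : ℂ → ℝ) : Prop where
  contDiffOn_fst : ContDiffOn ℝ 1 P (ball 0 1)
  contDiffOn_snd : ContDiffOn ℝ 1 Q (ball 0 1)
  symm : ∀ w ∈ ball (0 : ℂ) 1, fderiv ℝ P w I = fderiv ℝ Q w 1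
  minimal : ∀ w ∈ ball (0 : ℂ) 1, (1 + Q w ^ 2) * fderiv ℝ P w 1
    - 2 * P w * Q w * fderiv ℝ P w I + (1 + P w ^ 2) * fderiv ℝ Q w I = 0

open Complex in
/-- The stereographic projection of the Gauss map of the graph with gradient `(P, Q)`. -/
noncomputable def gaussProj (P Q : ℂ → ℝ) (w : ℂ) : ℂ :=
  ((1 + √(1 + P w ^ 2 + Q w ^ 2))⁻¹ : ℝ) • (Q w + P w * I)

open Complex in
theorem norm_gaussProj_lt_one (P Q : ℂ → ℝ) (w : ℂ) : ‖gaussProj P Q w‖ < 1 := by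
  set n := √(1 + P w ^ 2 + Q w ^ 2) with hn
  have hn2 : n ^ 2 = 1 + P w ^ 2 + Q w ^ 2 := Real.sq_sqrt (by positivity)
  have hn0 : 0 ≤ n := Real.sqrt_nonneg _
  rw [gaussProj, ← hn, norm_smul, Real.norm_of_nonneg (by positivity), inv_mul_lt_iff₀ (by positivity),
    Complex.norm_add_mul_I, mul_one]
  rw [Real.sqrt_lt' (by positivity)]
  nlinarith

open Complex in
theorem contDiffOn_gaussProj {P Q : ℂ → ℝ} {s : Set ℂ} (hP : ContDiffOn ℝ 1 P s)
    (hQ : ContDiffOn ℝ 1 Q s) : ContDiffOn ℝ 1 (gaussProj P Q) s := by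
  unfold gaussProj
  refine ContDiffOn.smul (ContDiffOn.inv (contDiffOn_const.add (ContDiffOn.sqrt
    ((contDiffOn_const.add (hP.pow 2)).add (hQ.pow 2)) fun x _ => by positivity))
    fun x _ => by positivity) ?_
  exact (ofRealCLM.contDiff.comp_contDiffOn hQ).add
    ((ofRealCLM.contDiff.comp_contDiffOn hP).mul contDiffOn_const)

open Complex in
theorem fderiv_gaussProj {P Q : ℂ → ℝ} {w : ℂ} (hP : DifferentiableAt ℝ P w)
    (hQ : DifferentiableAt ℝ Q w) (v : ℂ) : fderiv ℝ (gaussProj P Q) w v =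
      (fderiv ℝ Q w v + fderiv ℝ P w v * I) / (1 + √(1 + P w ^ 2 + Q w ^ 2)) -
      (Q w + P w * I) * ((P w * fderiv ℝ P w v + Q w * fderiv ℝ Q w v) /
        √(1 + P w ^ 2 + Q w ^ 2)) / (1 + √(1 + P w ^ 2 + Q w ^ 2)) ^ 2 := by
  have hpos : 0 < 1 + P w ^ 2 + Q w ^ 2 := by positivity
  have hs := ((((hP.hasFDerivAt.pow 2).const_add 1).add (hQ.hasFDerivAt.pow 2)).sqrt hpos.ne')
  have hn0 : 0 < √(1 + P w ^ 2 + Q w ^ 2) := Real.sqrt_pos.2 hpos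
  have hi := (hasDerivAt_inv (show 1 + √(1 + P w ^ 2 + Q w ^ 2) ≠ 0 by positivity)).comp_hasFDerivAt
    w (hs.const_add 1)
  have hg := (ofRealCLM.hasFDerivAt.comp w hQ.hasFDerivAt).add
    ((ofRealCLM.hasFDerivAt.comp w hP.hasFDerivAt).mul_const I)
  have h := hi.smul hg
  have h' : HasFDerivAt (gaussProj P Q) _ w := h
  rw [h'.fderiv]
  have hnC : (1 + √(1 + P w ^ 2 + Q w ^ 2) : ℂ) ≠ 0 := by
    have : (1 + √(1 + P w ^ 2 + Q w ^ 2) : ℝ) ≠ 0 := by positivity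
    exact_mod_cast this
  have hnC' : (√(1 + P w ^ 2 + Q w ^ 2) : ℂ) ≠ 0 := by exact_mod_cast hn0.ne'
  simp
  field_simp
  ring

namespace IsMinimalGradient

open Complex ComplexConjugate Metric

variable {P Q : ℂ → ℝ}

theorem differentiableAt_fst (h : IsMinimalGradient P Q) {w : ℂ} (hw : w ∈ ball (0 : ℂ) 1) :
    DifferentiableAt ℝ P w :=
  (h.contDiffOn_fst.differentiableOn one_ne_zero).differentiableAt (isOpen_ball.mem_nhds hw)

theorem differentiableAt_snd (h : IsMinimalGradient P Q) {w : ℂ} (hw : w ∈ ball (0 : ℂ) 1) :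
    DifferentiableAt ℝ Q w :=
  (h.contDiffOn_snd.differentiableOn one_ne_zero).differentiableAt (isOpen_ball.mem_nhds hw)

/-- The Beltrami equation for the Gauss map of a minimal graph. -/
theorem hasFDerivAt_gaussProj (h : IsMinimalGradient P Q) {w : ℂ} (hw : w ∈ ball (0 : ℂ) 1) :
    HasFDerivAt (gaussProj P Q)
      (wirt ((fderiv ℝ (gaussProj P Q) w 1 - I * fderiv ℝ (gaussProj P Q) w I) / 2)
        (-(conj (gaussProj P Q w)) ^ 2 *
          ((fderiv ℝ (gaussProj P Q) w 1 - I * fderiv ℝ (gaussProj P Q) w I) / 2))) w := by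
  have hd : DifferentiableAt ℝ (gaussProj P Q) w :=
    ((contDiffOn_gaussProj h.contDiffOn_fst h.contDiffOn_snd).differentiableOn
      one_ne_zero).differentiableAt (isOpen_ball.mem_nhds hw)
  have hL := eq_wirt (fderiv ℝ (gaussProj P Q) w)
  refine hd.hasFDerivAt.congr_fderiv (hL.trans ?_)
  congr 1
  rw [fderiv_gaussProj (h.differentiableAt_fst hw) (h.differentiableAt_snd hw),
    fderiv_gaussProj (h.differentiableAt_fst hw) (h.differentiableAt_snd hw), ← h.symm w hw]
  have hM := h.minimal w hw
  rw [gaussProj]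
  set p := P w
  set q := Q w
  set n := √(1 + p ^ 2 + q ^ 2) with hn
  set pu := fderiv ℝ P w 1
  set pv := fderiv ℝ P w I
  set qv := fderiv ℝ Q w I
  have hpos : 0 < 1 + p ^ 2 + q ^ 2 := by positivity
  have hn2 : n ^ 2 = 1 + p ^ 2 + q ^ 2 := Real.sq_sqrt hpos.le
  have hn0 : 0 < n := Real.sqrt_pos.2 hpos
  have hr : (1 + n : ℂ) ≠ 0 := by
    have : (1 + n : ℝ) ≠ 0 := by positivity
    exact_mod_cast this
  have hnC : (n : ℂ) ≠ 0 := by exact_mod_cast hn0.ne'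
  have hMC : (1 + q ^ 2) * pu - 2 * p * q * pv + (1 + p ^ 2) * qv = (0 : ℂ) := by exact_mod_cast hM
  have hnC2 : (n : ℂ) ^ 2 = 1 + p ^ 2 + q ^ 2 := by exact_mod_cast hn2
  have hc : conj ((1 + n)⁻¹ • (q + p * I : ℂ)) = (q - p * I) / (1 + n) := by
    rw [real_smul, map_mul, conj_ofReal, map_add, map_mul, conj_ofReal, conj_ofReal, conj_I]
    push_cast
    field_simp
    ring
  rw [hc]
  clear_value p q n pu pv qv
  have hgg : (q - p * I) * (q + p * I) - (n - 1) * (1 + n) = (0 : ℂ) := by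
    linear_combination -hnC2 - p ^ 2 * I_sq
  have key : n * (1 + n) ^ 2 * (pv + pu * I + I * (qv + pv * I))
      - (1 + n) * (q + p * I) * (p * pu + q * pv + I * (p * pv + q * qv))
      + n * (q - p * I) ^ 2 * (pv + pu * I - I * (qv + pv * I))
      - (q - p * I) * (n - 1) * (p * pu + q * pv - I * (p * pv + q * qv)) = (0 : ℂ) := by
    linear_combination 2 * I * (1 + n) * hMC + I * (pu + qv) * (n + 2) * hnC2 + (n * (1 + n) ^ 2 * pv
      - (1 + n) * p * (p * pv + q * qv) + n * (-(q - p * I) ^ 2 * pv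
      + 2 * p ^ 2 * pv - 2 * p * q * (pu - qv) + p ^ 2 * (pu - qv) * I)
      - (n - 1) * p * (p * pv + q * qv)) * I_sq
  rw [← sub_eq_zero]
  calc _ = (n * (1 + n) ^ 2 * (pv + pu * I + I * (qv + pv * I))
      - (1 + n) * (q + p * I) * (p * pu + q * pv + I * (p * pv + q * qv))
      + n * (q - p * I) ^ 2 * (pv + pu * I - I * (qv + pv * I))
      - (q - p * I) * (n - 1) * (p * pu + q * pv - I * (p * pv + q * qv))) / (2 * n * (1 + n) ^ 3)
      - (q - p * I) * (p * pu + q * pv - I * (p * pv + q * qv)) *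
        ((q - p * I) * (q + p * I) - (n - 1) * (1 + n)) / (2 * n * (1 + n) ^ 4 : ℂ) := by
        field_simp
        ring
    _ = 0 := by rw [key, hgg]; simp

theorem continuousOn_deriv_gaussProj (h : IsMinimalGradient P Q) : ContinuousOn
    (fun w => (fderiv ℝ (gaussProj P Q) w 1 - I * fderiv ℝ (gaussProj P Q) w I) / 2)
    (ball 0 1) := by
  have hc : ContinuousOn (fderiv ℝ (gaussProj P Q)) (ball 0 1) :=
    (contDiffOn_gaussProj h.contDiffOn_fst h.contDiffOn_snd).continuousOn_fderiv_of_isOpen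
      isOpen_ball le_rfl
  exact ((hc.clm_apply continuousOn_const).sub
    (continuousOn_const.mul (hc.clm_apply continuousOn_const))).div_const 2

theorem deriv_gaussProj_zero (h : IsMinimalGradient P Q) (hP : P 0 = 0)
    (hPI : fderiv ℝ P 0 I = 0) :
    (fderiv ℝ (gaussProj P Q) 0 1 - I * fderiv ℝ (gaussProj P Q) 0 I) / 2 =
      I * fderiv ℝ P 0 1 / 2 := by
  have h0 : (0 : ℂ) ∈ ball (0 : ℂ) 1 := mem_ball_self one_pos
  have hM := h.minimal 0 h0
  rw [fderiv_gaussProj (h.differentiableAt_fst h0) (h.differentiableAt_snd h0),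
    fderiv_gaussProj (h.differentiableAt_fst h0) (h.differentiableAt_snd h0), ← h.symm 0 h0, hPI, hP]
  rw [hPI, hP] at hM
  set q := Q 0
  set n := √(1 + 0 ^ 2 + q ^ 2) with hn
  set pu := fderiv ℝ P 0 1
  set qv := fderiv ℝ Q 0 I
  have hpos : 0 < 1 + 0 ^ 2 + q ^ 2 := by positivity
  have hn2 : n ^ 2 = 1 + 0 ^ 2 + q ^ 2 := Real.sq_sqrt hpos.le
  have hn0 : 0 < n := Real.sqrt_pos.2 hpos
  have hr : (1 + n : ℂ) ≠ 0 := by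
    have : (1 + n : ℝ) ≠ 0 := by positivity
    exact_mod_cast this
  have hnC : (n : ℂ) ≠ 0 := by exact_mod_cast hn0.ne'
  have hqv : (qv : ℂ) = -(n ^ 2 * pu) := by
    have : qv = -(n ^ 2 * pu) := by rw [hn2]; linarith
    exact_mod_cast this
  have hnC2 : (q : ℂ) ^ 2 = n ^ 2 - 1 := by
    have : q ^ 2 = n ^ 2 - 1 := by linarith
    exact_mod_cast this
  clear_value q n pu qv
  rw [hqv]
  push_cast
  field_simp
  ring_nf
  rw [hnC2]
  ring

end IsMinimalGradient

open Complex Metric in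
theorem scherk_denominator_ne_zero {b : ℝ} (hb : |b| < 1) {z : ℂ} (hz : z ∈ ball (0 : ℂ) 1) :
    (1 - z ^ 2) * (1 + 2 * b * z + z ^ 2) ≠ 0 := by
  rw [mem_ball_zero_iff] at hz
  have hn : z.re ^ 2 + z.im ^ 2 < 1 := by
    have h1 := Complex.sq_norm z
    rw [normSq_apply] at h1
    nlinarith [norm_nonneg z]
  refine mul_ne_zero (fun h0 => ?_) fun h0 => ?_
  · have h1 : ‖z ^ 2‖ = 1 := by rw [← sub_eq_zero.1 h0, norm_one]
    rw [norm_pow] at h1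
    nlinarith [norm_nonneg z]
  · have hre := congrArg Complex.re h0
    have him := congrArg Complex.im h0
    simp [pow_two] at hre him
    have hb2 : b ^ 2 < 1 := (sq_lt_one_iff_abs_lt_one b).2 hb
    rcases mul_eq_zero.1 (show z.im * (b + z.re) = 0 by linarith) with h1 | h1
    · rw [h1] at hre
      nlinarith [sq_nonneg (z.re + b)]
    · rw [show b = -z.re by linarith] at hre
      nlinarith

namespace IsMinimalGradient

open Complex ComplexConjugate Metric Topology Filter

variable {P Q : ℂ → ℝ}

theorem gaussProj_zero (hP : P 0 = 0) : gaussProj P Q 0 = ((Q 0 / (1 + √(1 + Q 0 ^ 2)) : ℝ) : ℂ) := by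
  simp [gaussProj, hP, div_eq_inv_mul]

theorem sq_fderiv_lt_of_neg (h : IsMinimalGradient P Q) (hP : P 0 = 0)
    (hPI : fderiv ℝ P 0 I = 0) (hQ : 0 ≤ Q 0) (hneg : fderiv ℝ P 0 1 < 0) :
    (fderiv ℝ P 0 1) ^ 2 < π ^ 2 / 2 * (1 + Q 0 ^ 2) := by
  by_contra! hle
  set p := fderiv ℝ P 0 1 with hp
  set n := √(1 + Q 0 ^ 2) with hn
  have hn2 : n ^ 2 = 1 + Q 0 ^ 2 := Real.sq_sqrt (by positivity)
  have hn1 : 1 ≤ n := Real.one_le_sqrt.2 (by nlinarith [sq_nonneg (Q 0)])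
  set κ : ℝ := Q 0 / (1 + n) with hκ
  have hκ0 : 0 ≤ κ := by positivity
  have hκ1 : κ < 1 := by
    rw [hκ, div_lt_one (by positivity)]
    nlinarith
  have hκ2 : κ ^ 2 * (n + 1) = n - 1 := by
    rw [hκ, div_pow, show Q 0 ^ 2 = (n - 1) * (n + 1) by nlinarith]; field_simp; ring
  set α : ℝ := 2 * √2 / π * (1 - κ ^ 2) / (1 + κ ^ 2) ^ 2 with hα
  obtain ⟨b, X₁, X₂, Y, μ, hb, hμ0, hμπ, hcos, hX₁, hX₂, hY, hX₁0, hX₂0, hN₁, hN₂⟩ :=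
    exists_scherk_parameters hκ0 hκ1 hα
  set G : ℂ → ℂ := fun z => I * α * (1 + κ * z) ^ 2 / ((1 - z ^ 2) * (1 + 2 * b * z + z ^ 2))
  have hpair : ContactPair κ (gaussProj P Q)
      (fun w => (fderiv ℝ (gaussProj P Q) w 1 - I * fderiv ℝ (gaussProj P Q) w I) / 2)
      (scherkMap X₁ X₂ Y μ) G :=
    { nonneg := hκ0
      lt_one := hκ1
      norm_q_lt := fun w _ => norm_gaussProj_lt_one P Q w
      hasFDerivAt_q := fun w hw => h.hasFDerivAt_gaussProj hw
      continuousOn_A := h.continuousOn_deriv_gaussProj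
      mapsTo_W := fun z hz =>
        mem_ball_zero_iff.2 (norm_scherkMap_lt_one hX₁0 hX₂0 hμ0 hμπ hN₁ hN₂ hz)
      hasFDerivAt_W := fun z hz =>
        hasFDerivAt_scherkMap hb (by rwa [abs_of_nonneg hκ0]) hcos hX₁ hX₂ hY hz
      continuousOn_G := by
        refine ContinuousOn.div (by fun_prop) (by fun_prop) fun z hz => ?_
        exact scherk_denominator_ne_zero hb hz
      W_zero := scherkMap_zero _ _ _ _
      q_zero := gaussProj_zero hP }
  have hw₁ : ((Y * (π - μ) : ℝ) : ℂ) * I ∈ ball (0 : ℂ) 1 := by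
    rw [mem_ball_zero_iff, norm_mul, norm_I, mul_one, norm_real, Real.norm_eq_abs]
    refine abs_lt_of_sq_lt_sq ?_ zero_le_one
    have : 0 < (π * X₁ / 2) ^ 2 := by positivity
    linarith
  have hs2 : (√2 : ℝ) ^ 2 = 2 := Real.sq_sqrt (by norm_num)
  have hκs : 0 < 1 - κ ^ 2 := by nlinarith
  have hnκ : n * (1 - κ ^ 2) = 1 + κ ^ 2 := by linarith
  have ht : π * n / (√2 * -p) ∈ Icc (0 : ℝ) 1 := by
    have hp' : 0 < -p := by linarith
    refine ⟨by positivity, ?_⟩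
    rw [div_le_one (by positivity)]
    refine (pow_le_pow_iff_left₀ (by positivity) (by positivity) two_ne_zero).1 ?_
    rw [mul_pow, mul_pow, hs2, hn2]
    linarith
  refine hpair.contactQuot_ne_zero hw₁ (tendsto_scherkMap hμ0 hμπ) ht (mem_ball_self one_pos) ?_
  have hG : G 0 = I * α := by simp [G]
  simp only [contactQuot, if_true]
  rw [h.deriv_gaussProj_zero hP hPI, hG, ← hp]
  have hreal : 1 - κ ^ 2 - π * n / (√2 * -p) * ((1 - κ ^ 4) * (-(α * p) / 2)) = 0 := by
    rw [hα]
    have hp0 := hneg.ne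
    field_simp
    rw [show (1 - κ ^ 4) = (1 - κ ^ 2) * (1 + κ ^ 2) by ring, ← hnκ]
    ring
  have hC : ((1 - κ ^ 2 - π * n / (√2 * -p) * ((1 - κ ^ 4) * (-(α * p) / 2)) : ℝ) : ℂ) = 0 := by
    rw [hreal, ofReal_zero]
  rw [← hC]
  push_cast
  linear_combination (-(π * n / (√2 * -p) * ((1 - κ ^ 4) * (α * p) / 2)) : ℂ) * I_sq

end IsMinimalGradient

open Complex in
theorem fderiv_linear_combination_comp {P Q : ℂ → ℝ} {L : ℂ →L[ℝ] ℂ} {w : ℂ}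
    (hP : DifferentiableAt ℝ P (L w)) (hQ : DifferentiableAt ℝ Q (L w)) (a c : ℝ) (v : ℂ) :
    fderiv ℝ (fun w => a * P (L w) + c * Q (L w)) w v =
      a * ((L v).re * fderiv ℝ P (L w) 1 + (L v).im * fderiv ℝ P (L w) I) +
      c * ((L v).re * fderiv ℝ Q (L w) 1 + (L v).im * fderiv ℝ Q (L w) I) := by
  have hd : HasFDerivAt (fun w => a * P (L w) + c * Q (L w)) _ w :=
    ((hP.hasFDerivAt.comp w L.hasFDerivAt).const_mul a).add
      ((hQ.hasFDerivAt.comp w L.hasFDerivAt).const_mul c)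
  have hx (F : ℂ →L[ℝ] ℝ) (x : ℂ) : F x = x.re * F 1 + x.im * F I := by
    conv_lhs => rw [show x = x.re • (1 : ℂ) + x.im • I by simp [re_add_im]]
    rw [map_add, map_smul, map_smul, smul_eq_mul, smul_eq_mul]
  rw [hd.fderiv, ← hx, ← hx]
  rfl

namespace IsMinimalGradient

open Complex ComplexConjugate Metric

variable {P Q : ℂ → ℝ}

theorem contDiffOn_linear_combination_comp (h : IsMinimalGradient P Q) {L : ℂ →L[ℝ] ℂ}
    (hL : MapsTo L (ball 0 1) (ball 0 1)) (a c : ℝ) :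
    ContDiffOn ℝ 1 (fun w => a * P (L w) + c * Q (L w)) (ball 0 1) :=
  (contDiffOn_const.mul (h.contDiffOn_fst.comp L.contDiff.contDiffOn hL)).add
    (contDiffOn_const.mul (h.contDiffOn_snd.comp L.contDiff.contDiffOn hL))

/-- The reflection of a minimal graph, followed by a change of sign. -/
theorem reflect (h : IsMinimalGradient P Q) {L : ℂ →L[ℝ] ℂ} (hL : L = (conjCLE : ℂ →L[ℝ] ℂ)) :
    IsMinimalGradient (fun w => -1 * P (L w) + 0 * Q (L w))
      (fun w => 0 * P (L w) + 1 * Q (L w)) := by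
  have hm : MapsTo L (ball 0 1) (ball 0 1) := fun w hw => by simpa [hL] using hw
  have hf (a c : ℝ) {w : ℂ} (hw : w ∈ ball (0 : ℂ) 1) (v : ℂ) :=
    fderiv_linear_combination_comp (h.differentiableAt_fst (hm hw))
      (h.differentiableAt_snd (hm hw)) a c v
  have h1 : L 1 = 1 := by simp [hL]
  have hI : L I = -I := by simp [hL]
  refine ⟨h.contDiffOn_linear_combination_comp hm _ _, h.contDiffOn_linear_combination_comp hm _ _,
    fun w hw => ?_, fun w hw => ?_⟩
  · rw [hf _ _ hw, hf _ _ hw, ← h.symm _ (hm hw), h1, hI, neg_re, neg_im, I_re, I_im, one_re, one_im]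
    ring
  · rw [hf _ _ hw, hf _ _ hw, hf _ _ hw, h1, hI, neg_re, neg_im, I_re, I_im, one_re, one_im]
    linear_combination -h.minimal _ (hm hw)

/-- A minimal graph in the coordinates rotated by the unit vector `(a, c)`. -/
theorem rotate (h : IsMinimalGradient P Q) {a c : ℝ} (hac : a ^ 2 + c ^ 2 = 1) {L : ℂ →L[ℝ] ℂ}
    (hL : L = ContinuousLinearMap.mul ℝ ℂ (a + c * I)) :
    IsMinimalGradient (fun w => a * P (L w) + c * Q (L w))
      (fun w => -c * P (L w) + a * Q (L w)) := by
  have hm : MapsTo L (ball 0 1) (ball 0 1) := fun w hw => by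
    rw [mem_ball_zero_iff] at *
    rwa [hL, ContinuousLinearMap.mul_apply', norm_mul, Complex.norm_add_mul_I, hac, Real.sqrt_one,
      one_mul]
  have hf (a c : ℝ) {w : ℂ} (hw : w ∈ ball (0 : ℂ) 1) (v : ℂ) :=
    fderiv_linear_combination_comp (h.differentiableAt_fst (hm hw))
      (h.differentiableAt_snd (hm hw)) a c v
  have r1 : (L 1).re = a := by simp [hL]
  have i1 : (L 1).im = c := by simp [hL]
  have rI : (L I).re = -c := by simp [hL]
  have iI : (L I).im = a := by simp [hL]
  refine ⟨h.contDiffOn_linear_combination_comp hm _ _, h.contDiffOn_linear_combination_comp hm _ _,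
    fun w hw => ?_, fun w hw => ?_⟩
  · rw [hf _ _ hw, hf _ _ hw, ← h.symm _ (hm hw), r1, i1, rI, iI]
    ring
  · rw [hf _ _ hw, hf _ _ hw, hf _ _ hw, ← h.symm _ (hm hw), r1, i1, rI, iI]
    linear_combination h.minimal _ (hm hw) + (fderiv ℝ P (L w) 1 + fderiv ℝ Q (L w) I +
      (a ^ 2 + c ^ 2 + 1) * (Q (L w) ^ 2 * fderiv ℝ P (L w) 1
        - 2 * P (L w) * Q (L w) * fderiv ℝ P (L w) I + P (L w) ^ 2 * fderiv ℝ Q (L w) I)) * hac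

theorem sq_fderiv_lt (h : IsMinimalGradient P Q) (hP : P 0 = 0)
    (hPI : fderiv ℝ P 0 I = 0) (hQ : 0 ≤ Q 0) :
    (fderiv ℝ P 0 1) ^ 2 < π ^ 2 / 2 * (1 + Q 0 ^ 2) := by
  rcases lt_trichotomy (fderiv ℝ P 0 1) 0 with h0 | h0 | h0
  · exact h.sq_fderiv_lt_of_neg hP hPI hQ h0
  · rw [h0, zero_pow two_ne_zero]; positivity
  · have hz : (0 : ℂ) ∈ ball (0 : ℂ) 1 := mem_ball_self one_pos
    obtain ⟨L, hL⟩ : ∃ L : ℂ →L[ℝ] ℂ, L = (conjCLE : ℂ →L[ℝ] ℂ) := ⟨_, rfl⟩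
    have hf (v : ℂ) := fderiv_linear_combination_comp (L := L) (w := 0)
      (P := P) (Q := Q) (by simpa using h.differentiableAt_fst hz)
      (by simpa using h.differentiableAt_snd hz) (-1) 0 v
    have h1 : L 1 = 1 := by simp [hL]
    have hI : L I = -I := by simp [hL]
    have key := (h.reflect hL).sq_fderiv_lt_of_neg
    rw [hf, hf, h1, hI, map_zero, hP, hPI] at key
    simpa using key (by simp) (by simp) (by simpa using hQ) (by simpa using h0)

/-- The determinant of the Hessian at a symmetric point of a minimal graph over the unit disk. -/
theorem abs_det_lt (h : IsMinimalGradient P Q) {a c : ℝ} (hac : a ^ 2 + c ^ 2 = 1)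
    (h1 : a * P 0 + c * Q 0 = 0)
    (h2 : a * (-c * fderiv ℝ P 0 1 + a * fderiv ℝ P 0 I) +
      c * (-c * fderiv ℝ P 0 I + a * fderiv ℝ Q 0 I) = 0) :
    |fderiv ℝ P 0 1 * fderiv ℝ Q 0 I - fderiv ℝ P 0 I ^ 2| <
      π ^ 2 / 2 * (1 + P 0 ^ 2 + Q 0 ^ 2) ^ 2 := by
  wlog hpos : 0 ≤ -c * P 0 + a * Q 0 generalizing a c
  · exact this (a := -a) (c := -c) (by linarith) (by linarith) (by linarith) (by linarith)
  have hz : (0 : ℂ) ∈ ball (0 : ℂ) 1 := mem_ball_self one_pos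
  obtain ⟨L, hL⟩ : ∃ L : ℂ →L[ℝ] ℂ, L = ContinuousLinearMap.mul ℝ ℂ (a + c * I) := ⟨_, rfl⟩
  have hf (v : ℂ) := fderiv_linear_combination_comp (L := L)
    (w := 0) (P := P) (Q := Q) (by simpa using h.differentiableAt_fst hz)
    (by simpa using h.differentiableAt_snd hz) a c v
  have r1 : (L 1).re = a := by simp [hL]
  have i1 : (L 1).im = c := by simp [hL]
  have rI : (L I).re = -c := by simp [hL]
  have iI : (L I).im = a := by simp [hL]
  have key := (h.rotate hac hL).sq_fderiv_lt
  have hm := h.minimal 0 hz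
  rw [hf, hf, map_zero, r1, i1, rI, iI, ← h.symm 0 hz] at key
  replace key := key h1 h2 hpos
  set p := P 0
  set q := Q 0
  set u := fderiv ℝ P 0 1
  set v := fderiv ℝ P 0 I
  set t := fderiv ℝ Q 0 I
  set m := a * (a * u + c * v) + c * (a * v + c * t)
  set y := -c * p + a * q
  have hpq : 1 + p ^ 2 + q ^ 2 = 1 + y ^ 2 := by
    linear_combination -(p ^ 2 + q ^ 2) * hac + (a * p + c * q) * h1
  have hp : p = -c * y := by linear_combination -p * hac + a * h1
  have hq : q = a * y := by linear_combination -q * hac + c * h1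
  have hdet : u * t - v ^ 2 = -((1 + y ^ 2) * m ^ 2) := by
    have h3 : u + t + y ^ 2 * m = 0 := by
      rw [hp, hq] at hm
      linear_combination hm
    have h4 : c * (c * u - a * v) + a * (-c * v + a * t) = -(1 + y ^ 2) * m := by
      linear_combination h3 + (u + t) * hac
    linear_combination m * h4 - (a ^ 2 + c ^ 2 + 1) * (u * t - v ^ 2) * hac
      - (a * (-c * u + a * v) + c * (-c * v + a * t)) * h2
  rw [hdet, abs_neg, abs_of_nonneg (by positivity), hpq]
  nlinarith [sq_nonneg y]

end IsMinimalGradient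

theorem isOpen_unitDisk : IsOpen unitDisk :=
  isOpen_lt (by fun_prop) continuous_const

section Graph

variable {f : ℝ × ℝ → ℝ} {x : ℝ × ℝ}

theorem lineDeriv_eq_of_mem_unitDisk (hf : ContDiffOn ℝ 2 f unitDisk) (hx : x ∈ unitDisk)
    (v : ℝ × ℝ) : lineDeriv ℝ f x v = fderiv ℝ f x v :=
  ((hf.differentiableOn two_ne_zero).differentiableAt
    (isOpen_unitDisk.mem_nhds hx)).lineDeriv_eq_fderiv

theorem contDiffOn_fderiv_unitDisk (hf : ContDiffOn ℝ 2 f unitDisk) :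
    ContDiffOn ℝ 1 (fderiv ℝ f) unitDisk :=
  hf.fderiv_of_isOpen isOpen_unitDisk (by norm_num)

theorem hasFDerivAt_lineDeriv (hf : ContDiffOn ℝ 2 f unitDisk) (hx : x ∈ unitDisk) (v : ℝ × ℝ) :
    HasFDerivAt (fun y => lineDeriv ℝ f y v) ((fderiv ℝ (fderiv ℝ f) x).flip v) x := by
  have hd := (((contDiffOn_fderiv_unitDisk hf).differentiableOn one_ne_zero).differentiableAt
    (isOpen_unitDisk.mem_nhds hx)).hasFDerivAt
  have h1 : HasFDerivAt (fun y => fderiv ℝ f y v) ((fderiv ℝ (fderiv ℝ f) x).flip v) x := by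
    have := hd.clm_apply (hasFDerivAt_const v x)
    refine this.congr_fderiv ?_
    ext <;> simp
  refine h1.congr_of_eventuallyEq ?_
  filter_upwards [isOpen_unitDisk.mem_nhds hx] with y hy
  exact lineDeriv_eq_of_mem_unitDisk hf hy v

theorem lineDeriv_lineDeriv (hf : ContDiffOn ℝ 2 f unitDisk) (hx : x ∈ unitDisk) (v w : ℝ × ℝ) :
    lineDeriv ℝ (fun y => lineDeriv ℝ f y v) x w = fderiv ℝ (fderiv ℝ f) x w v :=
  (hasFDerivAt_lineDeriv hf hx v).hasLineDerivAt w |>.lineDeriv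

theorem fderiv_fderiv_symm (hf : ContDiffOn ℝ 2 f unitDisk) (hx : x ∈ unitDisk) (v w : ℝ × ℝ) :
    fderiv ℝ (fderiv ℝ f) x v w = fderiv ℝ (fderiv ℝ f) x w v :=
  ((hf.contDiffAt (isOpen_unitDisk.mem_nhds hx)).isSymmSndFDerivAt (by simp)) v w

theorem contDiffOn_lineDeriv (hf : ContDiffOn ℝ 2 f unitDisk) (v : ℝ × ℝ) :
    ContDiffOn ℝ 1 (fun y => lineDeriv ℝ f y v) unitDisk :=
  ((contDiffOn_fderiv_unitDisk hf).clm_apply contDiffOn_const).congr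
    fun _ hy => lineDeriv_eq_of_mem_unitDisk hf hy v

open Complex Metric in
theorem mapsTo_equivRealProdCLM : MapsTo equivRealProdCLM (ball (0 : ℂ) 1) unitDisk := fun w hw => by
  rw [mem_ball_zero_iff] at hw
  have h1 := Complex.sq_norm w
  rw [normSq_apply] at h1
  change w.re ^ 2 + w.im ^ 2 < 1
  nlinarith [norm_nonneg w]

open Complex Metric in
theorem fderiv_lineDeriv_comp (hf : ContDiffOn ℝ 2 f unitDisk) {w : ℂ} (hw : w ∈ ball (0 : ℂ) 1)
    (v : ℝ × ℝ) (z : ℂ) : fderiv ℝ (fun w => lineDeriv ℝ f (equivRealProdCLM w) v) w z =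
      fderiv ℝ (fderiv ℝ f) (equivRealProdCLM w) (equivRealProdCLM z) v := by
  have h := (hasFDerivAt_lineDeriv hf (mapsTo_equivRealProdCLM hw) v).comp w
    equivRealProdCLM.hasFDerivAt
  have h' : HasFDerivAt (fun w => lineDeriv ℝ f (equivRealProdCLM w) v) _ w := h
  rw [h'.fderiv]
  rfl

open Complex Metric in
theorem isMinimalGradient_of_minimalSurfaceEq (hf : ContDiffOn ℝ 2 f unitDisk)
    (hmin : MinimalSurfaceEq f unitDisk) :
    IsMinimalGradient (fun w => lineDeriv ℝ f (equivRealProdCLM w) (1, 0))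
      (fun w => lineDeriv ℝ f (equivRealProdCLM w) (0, 1)) := by
  have e1 : equivRealProdCLM 1 = (1, 0) := by simp
  have eI : equivRealProdCLM I = (0, 1) := by simp
  refine ⟨(contDiffOn_lineDeriv hf _).comp equivRealProdCLM.contDiff.contDiffOn
      mapsTo_equivRealProdCLM, (contDiffOn_lineDeriv hf _).comp equivRealProdCLM.contDiff.contDiffOn
      mapsTo_equivRealProdCLM, fun w hw => ?_, fun w hw => ?_⟩
  · rw [fderiv_lineDeriv_comp hf hw, fderiv_lineDeriv_comp hf hw, e1, eI,
      fderiv_fderiv_symm hf (mapsTo_equivRealProdCLM hw)]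
  · have hm := hmin _ (mapsTo_equivRealProdCLM hw)
    unfold pdu pdv at hm
    rw [lineDeriv_lineDeriv hf (mapsTo_equivRealProdCLM hw),
      lineDeriv_lineDeriv hf (mapsTo_equivRealProdCLM hw),
      lineDeriv_lineDeriv hf (mapsTo_equivRealProdCLM hw)] at hm
    rw [fderiv_lineDeriv_comp hf hw, fderiv_lineDeriv_comp hf hw, fderiv_lineDeriv_comp hf hw, e1, eI]
    exact hm

end Graph

/-- **Kalaj, Theorem 3 (curvature bound).**  If `f` is a `C²` solution of the minimal
surface equation on the unit disk and the point above the origin is symmetric, then the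
Gaussian curvature at the point above the origin satisfies `|K| < π²/2`. -/
theorem curvature_lt_of_symmetric (f : ℝ × ℝ → ℝ)
    (hreg : ContDiffOn ℝ 2 f unitDisk)
    (hmin : MinimalSurfaceEq f unitDisk)
    (h : ℝ × ℝ) (hsym : IsSymmetricPt f (0, 0) h) :
    |gaussCurv f (0, 0)| < Real.pi ^ 2 / 2 := by
  obtain ⟨a, c⟩ := h
  obtain ⟨hh, h1, h2⟩ := hsym
  simp only at hh h2
  have hx : ((0 : ℝ), (0 : ℝ)) ∈ unitDisk := by simp [unitDisk]
  have e0 : Complex.equivRealProdCLM 0 = (0, 0) := by simp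
  have e1 : Complex.equivRealProdCLM 1 = (1, 0) := by simp
  have eI : Complex.equivRealProdCLM Complex.I = (0, 1) := by simp
  have hz : (0 : ℂ) ∈ Metric.ball (0 : ℂ) 1 := Metric.mem_ball_self one_pos
  have key := (isMinimalGradient_of_minimalSurfaceEq hreg hmin).abs_det_lt hh
  simp only [fderiv_lineDeriv_comp hreg hz, e0, e1, eI] at key
  have decomp (a c : ℝ) : (a, c) = a • ((1 : ℝ), (0 : ℝ)) + c • ((0 : ℝ), (1 : ℝ)) := by simp
  rw [lineDeriv_eq_of_mem_unitDisk hreg hx, decomp a c, map_add, map_smul, map_smul] at h1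
  rw [lineDeriv_lineDeriv hreg hx, decomp a c, decomp (-c) a] at h2
  simp only [map_add, map_smul, add_apply, smul_apply,
    smul_eq_mul] at h1 h2
  have hs := fderiv_fderiv_symm hreg hx (0, 1) (1, 0)
  unfold gaussCurv pdu pdv
  rw [lineDeriv_lineDeriv hreg hx, lineDeriv_lineDeriv hreg hx, lineDeriv_lineDeriv hreg hx]
  have hpos : 0 < (1 + lineDeriv ℝ f (0, 0) (1, 0) ^ 2 + lineDeriv ℝ f (0, 0) (0, 1) ^ 2) ^ 2 := by
    positivity
  rw [abs_div, abs_of_pos hpos, div_lt_iff₀ hpos]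
  refine key ?_ ?_
  · rw [lineDeriv_eq_of_mem_unitDisk hreg hx, lineDeriv_eq_of_mem_unitDisk hreg hx]
    exact h1
  · rw [← hs] at h2
    linarith
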